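/- arXiv:1310.2380 — 5 statements merged into one kernel-verified Lean document; each statement's English description precedes it below -/
import Mathlib

section
/- Let Ω: U→V be a nonexpansive linear operator between Banach spaces with the Gurarii property, let ε>0, let T: X₀→Y₀ and R: X₁→Y₁ be nonexpansive linear operators between finite-dimensional Banach spaces, let f = (f₀,f₁) be an ε-embedding of operators from T into R, and let e = (e₀,e₁) be an embedding of operators from T into Ω. Then for every δ>0 there exists a δ-embedding of operators g = (g₀,g₁) from R into Ω such that the composition (g₀∘f₀, g₁∘f₁) is (2ε+δ)-close to (e₀,e₁). -/
/-- `f` is an `ε`-isometric embedding: `(1+ε)⁻¹‖x‖ ≤ ‖f x‖ ≤ ‖x‖`. -/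
def IsEpsIsometry {X Y : Type*} [NormedAddCommGroup X] [NormedAddCommGroup Y]
    (ε : ℝ) (f : X → Y) : Prop :=
  ∀ x : X, (1 + ε)⁻¹ * ‖x‖ ≤ ‖f x‖ ∧ ‖f x‖ ≤ ‖x‖

/-- Condition (G): the Gurarii property of an operator `Ω : U → V`. -/
def HasGurariiProperty {U V : Type*} [NormedAddCommGroup U] [NormedSpace ℝ U]
    [NormedAddCommGroup V] [NormedSpace ℝ V] (Ω : U →L[ℝ] V) : Prop :=
  ∀ (ε : ℝ), 0 < ε →
    ∀ (X Y : Type) [NormedAddCommGroup X] [NormedSpace ℝ X] [FiniteDimensional ℝ X]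
      [NormedAddCommGroup Y] [NormedSpace ℝ Y] [FiniteDimensional ℝ Y]
      (X₀ : Submodule ℝ X) (Y₀ : Submodule ℝ Y) (T : X →L[ℝ] Y),
      ‖T‖ ≤ 1 →
      ∀ (hT : ∀ x ∈ X₀, T x ∈ Y₀) (i : X₀ →ₗᵢ[ℝ] U) (j : Y₀ →ₗᵢ[ℝ] V),
        (∀ x : X₀, Ω (i x) = j ⟨T x, hT x x.2⟩) →
        ∃ (i' : X →L[ℝ] U) (j' : Y →L[ℝ] V),
          IsEpsIsometry ε i' ∧ IsEpsIsometry ε j' ∧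
          ‖i'.comp X₀.subtypeL - i.toContinuousLinearMap‖ < ε ∧
          ‖j'.comp Y₀.subtypeL - j.toContinuousLinearMap‖ < ε ∧
          ‖Ω.comp i' - j'.comp T‖ < ε

/-- Condition (G*): as (G) but with exact commutation `Ω ∘ i' = j' ∘ T`. -/
def HasGurariiStarProperty {U V : Type*} [NormedAddCommGroup U] [NormedSpace ℝ U]
    [NormedAddCommGroup V] [NormedSpace ℝ V] (Ω : U →L[ℝ] V) : Prop :=
  ∀ (ε : ℝ), 0 < ε →
    ∀ (X Y : Type) [NormedAddCommGroup X] [NormedSpace ℝ X] [FiniteDimensional ℝ X]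
      [NormedAddCommGroup Y] [NormedSpace ℝ Y] [FiniteDimensional ℝ Y]
      (X₀ : Submodule ℝ X) (Y₀ : Submodule ℝ Y) (T : X →L[ℝ] Y),
      ‖T‖ ≤ 1 →
      ∀ (hT : ∀ x ∈ X₀, T x ∈ Y₀) (i : X₀ →ₗᵢ[ℝ] U) (j : Y₀ →ₗᵢ[ℝ] V),
        (∀ x : X₀, Ω (i x) = j ⟨T x, hT x x.2⟩) →
        ∃ (i' : X →L[ℝ] U) (j' : Y →L[ℝ] V),
          IsEpsIsometry ε i' ∧ IsEpsIsometry ε j' ∧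
          ‖i'.comp X₀.subtypeL - i.toContinuousLinearMap‖ < ε ∧
          ‖j'.comp Y₀.subtypeL - j.toContinuousLinearMap‖ < ε ∧
          Ω.comp i' = j'.comp T

/-- Condition (g): the defining extension property of the Gurarii space. -/
def SatisfiesConditionSmallG (W : Type*) [NormedAddCommGroup W] [NormedSpace ℝ W] : Prop :=
  ∀ (ε : ℝ), 0 < ε →
    ∀ (X : Type) [NormedAddCommGroup X] [NormedSpace ℝ X] [FiniteDimensional ℝ X]
      (X₀ : Submodule ℝ X) (i : X₀ →ₗᵢ[ℝ] W),
      ∃ f : X →L[ℝ] W, IsEpsIsometry ε f ∧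
        ‖f.comp X₀.subtypeL - i.toContinuousLinearMap‖ ≤ ε

/-- Auxiliary amalgam: the bare vector space `X × Y` without its product norm. -/
def AmalgamCarrier (X Y : Type*) : Type _ := X × Y

instance (X Y : Type*) [AddCommGroup X] [AddCommGroup Y] : AddCommGroup (AmalgamCarrier X Y) :=
  inferInstanceAs (AddCommGroup (X × Y))

instance (X Y : Type*) [AddCommGroup X] [AddCommGroup Y] [Module ℝ X] [Module ℝ Y] :
    Module ℝ (AmalgamCarrier X Y) :=
  inferInstanceAs (Module ℝ (X × Y))

/-- A bare copy of `ℝⁿ` without norm. -/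
def BareCarrier (n : ℕ) : Type := Fin n → ℝ

instance (n : ℕ) : AddCommGroup (BareCarrier n) := inferInstanceAs (AddCommGroup (Fin n → ℝ))

instance (n : ℕ) : Module ℝ (BareCarrier n) := inferInstanceAs (Module ℝ (Fin n → ℝ))

/-- Every finite-dimensional normed space has an isometric copy in `Type`. -/
lemma exists_small_copy (A : Type*) [NormedAddCommGroup A] [NormedSpace ℝ A]
    [FiniteDimensional ℝ A] :
    ∃ (A' : Type) (_ : NormedAddCommGroup A') (_ : NormedSpace ℝ A')
      (_ : FiniteDimensional ℝ A'), Nonempty (A' ≃ₗᵢ[ℝ] A) := by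
  let L : BareCarrier (Module.finrank ℝ A) ≃ₗ[ℝ] A := (Module.finBasis ℝ A).equivFun.symm
  let i1 : NormedAddCommGroup (BareCarrier (Module.finrank ℝ A)) :=
    NormedAddCommGroup.induced _ A L L.injective
  let i2 : NormedSpace ℝ (BareCarrier (Module.finrank ℝ A)) :=
    NormedSpace.induced ℝ _ A L
  refine ⟨_, i1, i2, ?_, ⟨⟨L, fun x => rfl⟩⟩⟩
  exact Module.Finite.equiv L.symm

/-- The amalgam of `X` and `Y` along an almost isometry `f`. -/
lemma exists_amalgam.{p1, p2, p3} {X : Type p1} {Y : Type p2} [NormedAddCommGroup X] [NormedSpace ℝ X]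
    [FiniteDimensional ℝ X] [NormedAddCommGroup Y] [NormedSpace ℝ Y] [FiniteDimensional ℝ Y]
    (f : X →L[ℝ] Y) (c : ℝ) (hc : 0 < c) (hf : ∀ x, ‖f x‖ ≤ ‖x‖)
    (hf' : ∀ x, ‖x‖ ≤ ‖f x‖ + c * ‖x‖) :
    ∃ (A : Type (max p1 p2)) (_ : NormedAddCommGroup A) (_ : NormedSpace ℝ A)
      (_ : FiniteDimensional ℝ A) (k₀ : X →ₗᵢ[ℝ] A) (k₁ : Y →ₗᵢ[ℝ] A),
      (∀ x, ‖k₀ x - k₁ (f x)‖ ≤ c * ‖x‖) ∧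
      (∀ (a : A) (r : ℝ), ‖a‖ < r → ∃ u v w, a = k₀ u + k₁ v + (k₀ w - k₁ (f w)) ∧
        ‖u‖ + ‖v‖ + c * ‖w‖ < r) ∧
      (∀ (C : Type p3) [AddCommGroup C] [Module ℝ C] (p : X →ₗ[ℝ] C) (q : Y →ₗ[ℝ] C),
        ∃ S : A →ₗ[ℝ] C, (∀ x, S (k₀ x) = p x) ∧ ∀ y, S (k₁ y) = q y) := by
  let F : AmalgamCarrier X Y → X → ℝ := fun a w => ‖a.1 - w‖ + ‖a.2 + f w‖ + c * ‖w‖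
  have hF0 : ∀ a w, 0 ≤ F a w := fun a w => by positivity
  have hbdd : ∀ a, BddBelow (Set.range (F a)) := fun a =>
    ⟨0, by rintro _ ⟨w, rfl⟩; exact hF0 a w⟩
  let nI : Norm (AmalgamCarrier X Y) := ⟨fun a => ⨅ w, F a w⟩
  have nle : ∀ (a : AmalgamCarrier X Y) w, ‖a‖ ≤ F a w := fun a w => ciInf_le (hbdd a) w
  have len : ∀ (a : AmalgamCarrier X Y) b, (∀ w, b ≤ F a w) → b ≤ ‖a‖ :=
    fun a b h => le_ciInf h
  have nlt : ∀ (a : AmalgamCarrier X Y) r, ‖a‖ < r → ∃ w, F a w < r :=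
    fun a r h => exists_lt_of_ciInf_lt h
  have hsm : ∀ (t : ℝ) (a : AmalgamCarrier X Y) w, F (t • a) (t • w) = |t| * F a w := by
    intro t a w
    change ‖t • a.1 - t • w‖ + ‖t • a.2 + f (t • w)‖ + c * ‖t • w‖ = _
    rw [map_smul, ← smul_sub, ← smul_add, norm_smul, norm_smul, norm_smul, Real.norm_eq_abs]
    simp only [F]; ring
  have hsle : ∀ (t : ℝ) (a : AmalgamCarrier X Y), t ≠ 0 → ‖t • a‖ ≤ |t| * ‖a‖ := by
    intro t a ht
    have htp : 0 < |t| := abs_pos.mpr ht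
    rw [← div_le_iff₀' htp]
    refine len _ _ fun w => ?_
    rw [div_le_iff₀' htp, ← hsm]
    exact nle _ _
  have core : NormedSpace.Core ℝ (AmalgamCarrier X Y) := by
    refine { norm_nonneg := fun a => len _ _ (hF0 a), norm_smul := ?_, norm_triangle := ?_, norm_eq_zero_iff := ?_ }
    · intro t a
      rw [Real.norm_eq_abs]
      by_cases ht : t = 0
      · subst ht
        rw [zero_smul, abs_zero, zero_mul]
        refine le_antisymm ?_ (len _ _ (hF0 _))
        refine (nle _ 0).trans ?_
        change ‖(0:X) - 0‖ + ‖(0:Y) + f 0‖ + c * ‖(0:X)‖ ≤ 0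
        simp
      · refine le_antisymm (hsle t a ht) ?_
        have h := hsle t⁻¹ (t • a) (inv_ne_zero ht)
        rw [smul_smul, inv_mul_cancel₀ ht, one_smul, abs_inv] at h
        rwa [← le_inv_mul_iff₀ (abs_pos.mpr ht)] 
    · intro a b
      refine le_of_forall_pos_lt_add fun η hη => ?_
      obtain ⟨w, hw⟩ := nlt a (‖a‖ + η / 2) (by linarith)
      obtain ⟨z, hz⟩ := nlt b (‖b‖ + η / 2) (by linarith)
      have h := nle (a + b) (w + z)
      have h2 : F (a + b) (w + z) ≤ F a w + F b z := by
        change ‖(a.1 + b.1) - (w + z)‖ + ‖(a.2 + b.2) + f (w + z)‖ + c * ‖w + z‖ ≤ _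
        have e1 : (a.1 + b.1) - (w + z) = (a.1 - w) + (b.1 - z) := by abel
        have e2 : (a.2 + b.2) + f (w + z) = (a.2 + f w) + (b.2 + f z) := by rw [map_add]; abel
        have h1 := norm_add_le (a.1 - w) (b.1 - z)
        have h2 := norm_add_le (a.2 + f w) (b.2 + f z)
        have h3 := mul_le_mul_of_nonneg_left (norm_add_le w z) hc.le
        rw [e1, e2]; simp only [F]; linarith
      linarith
    · intro a
      constructor
      · intro h
        have key : ∀ η > 0, c * ‖a.1‖ ≤ (c + 1) * η ∧ c * ‖a.2‖ ≤ (c + 1) * η := by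
          intro η hη
          obtain ⟨w, hw⟩ := nlt a η (by rw [h]; exact hη)
          simp only [F] at hw
          have h1 : ‖a.1‖ ≤ ‖a.1 - w‖ + ‖w‖ := by
            simpa using norm_add_le (a.1 - w) w
          have h2 : ‖a.2‖ ≤ ‖a.2 + f w‖ + ‖f w‖ := by
            simpa using norm_sub_le (a.2 + f w) (f w)
          have h3 := hf w
          have p1 := norm_nonneg (a.1 - w)
          have p2 := norm_nonneg (a.2 + f w)
          have p3 : 0 ≤ c * ‖w‖ := by positivity
          constructor
          · have := mul_le_mul_of_nonneg_left h1 hc.le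
            have q : c * ‖a.1 - w‖ ≤ c * η := by gcongr; linarith
            linarith
          · have := mul_le_mul_of_nonneg_left (h2.trans (add_le_add_right h3 _)) hc.le
            have q : c * ‖a.2 + f w‖ ≤ c * η := by gcongr; linarith
            linarith
        have lim : ∀ s : ℝ, (∀ η > 0, c * s ≤ (c + 1) * η) → s ≤ 0 := by
          intro s hs
          by_contra! hcon
          have := hs (c * s / (2 * (c + 1))) (by positivity)
          have e : (c + 1) * (c * s / (2 * (c + 1))) = c * s / 2 := by field_simp
          rw [e] at this
          have : 0 < c * s := by positivity
          linarith
        have h1 : a.1 = 0 := norm_le_zero_iff.mp (lim _ fun η hη => (key η hη).1)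
        have h2 : a.2 = 0 := norm_le_zero_iff.mp (lim _ fun η hη => (key η hη).2)
        exact Prod.ext h1 h2
      · rintro rfl
        refine le_antisymm ?_ (len _ _ (hF0 _))
        refine (nle _ 0).trans ?_
        change ‖(0:X) - 0‖ + ‖(0:Y) + f 0‖ + c * ‖(0:X)‖ ≤ 0
        simp
  let i1 : NormedAddCommGroup (AmalgamCarrier X Y) := NormedAddCommGroup.ofCore core
  let i2 : NormedSpace ℝ (AmalgamCarrier X Y) := NormedSpace.ofCore core
  let l₀ : X →ₗ[ℝ] AmalgamCarrier X Y := LinearMap.inl ℝ X Y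
  let l₁ : Y →ₗ[ℝ] AmalgamCarrier X Y := LinearMap.inr ℝ X Y
  have hl₀ : ∀ x, ‖l₀ x‖ = ‖x‖ := by
    intro x
    apply le_antisymm
    · refine (nle _ 0).trans ?_
      change ‖x - 0‖ + ‖(0:Y) + f 0‖ + c * ‖(0:X)‖ ≤ _
      simp
    · refine len _ _ fun w => ?_
      change _ ≤ ‖x - w‖ + ‖(0:Y) + f w‖ + c * ‖w‖
      have h1 : ‖x‖ ≤ ‖x - w‖ + ‖w‖ := by simpa using norm_add_le (x - w) w
      have := hf' w
      rw [zero_add]; linarith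
  have hl₁ : ∀ y, ‖l₁ y‖ = ‖y‖ := by
    intro y
    apply le_antisymm
    · refine (nle _ 0).trans ?_
      change ‖(0:X) - 0‖ + ‖y + f 0‖ + c * ‖(0:X)‖ ≤ _
      simp
    · refine len _ _ fun w => ?_
      change _ ≤ ‖(0:X) - w‖ + ‖y + f w‖ + c * ‖w‖
      have h2 : ‖y‖ ≤ ‖y + f w‖ + ‖f w‖ := by simpa using norm_sub_le (y + f w) (f w)
      have := hf w
      have p3 : 0 ≤ c * ‖w‖ := by positivity
      rw [zero_sub, norm_neg]; linarith
  refine ⟨AmalgamCarrier X Y, i1, i2, inferInstanceAs (Module.Finite ℝ (X × Y)),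
    ⟨l₀, hl₀⟩, ⟨l₁, hl₁⟩, ?_, ?_, ?_⟩
  · intro x
    refine (nle _ x).trans ?_
    change ‖(x - 0) - x‖ + ‖(0 - f x) + f x‖ + c * ‖x‖ ≤ _
    simp
  · intro a r h
    obtain ⟨w, hw⟩ := nlt a r h
    refine ⟨a.1 - w, a.2 + f w, w, ?_, hw⟩
    change a = ((a.1 - w + 0 + (w - 0), 0 + (a.2 + f w) + (0 - f w)) : X × Y)
    refine Prod.ext ?_ ?_
    · change a.1 = a.1 - w + 0 + (w - 0); abel
    · change a.2 = 0 + (a.2 + f w) + (0 - f w); abel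
  · intro C _ _ p q
    refine ⟨(LinearMap.coprod p q : X × Y →ₗ[ℝ] C), fun x => ?_, fun y => ?_⟩
    · change LinearMap.coprod p q (x, 0) = _
      simp
    · change LinearMap.coprod p q (0, y) = _
      simp

/-- The Gurarii property phrased with isometric embeddings, for spaces in `Type`. -/
lemma gurarii_embed_small {U V : Type*} [NormedAddCommGroup U] [NormedSpace ℝ U]
    [NormedAddCommGroup V] [NormedSpace ℝ V] (Ω : U →L[ℝ] V) (hG : HasGurariiProperty Ω)
    (η : ℝ) (hη : 0 < η) (A B : Type) {X Y : Type*}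
    [NormedAddCommGroup A] [NormedSpace ℝ A] [FiniteDimensional ℝ A]
    [NormedAddCommGroup B] [NormedSpace ℝ B] [FiniteDimensional ℝ B]
    [NormedAddCommGroup X] [NormedSpace ℝ X] [NormedAddCommGroup Y] [NormedSpace ℝ Y]
    (S : A →L[ℝ] B) (hS : ‖S‖ ≤ 1) (T : X →L[ℝ] Y)
    (k : X →ₗᵢ[ℝ] A) (l : Y →ₗᵢ[ℝ] B) (hkl : ∀ x, S (k x) = l (T x))
    (e₀ : X →ₗᵢ[ℝ] U) (e₁ : Y →ₗᵢ[ℝ] V) (he : ∀ x, Ω (e₀ x) = e₁ (T x)) :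
    ∃ (i : A →L[ℝ] U) (j : B →L[ℝ] V), IsEpsIsometry η i ∧ IsEpsIsometry η j ∧
      (∀ x, ‖i (k x) - e₀ x‖ ≤ η * ‖x‖) ∧ (∀ y, ‖j (l y) - e₁ y‖ ≤ η * ‖y‖) ∧
      ∀ a, ‖Ω (i a) - j (S a)‖ ≤ η * ‖a‖ := by
  have hm : ∀ x ∈ LinearMap.range k.toLinearMap, S x ∈ LinearMap.range l.toLinearMap := by
    rintro _ ⟨x, rfl⟩
    exact ⟨T x, (hkl x).symm⟩
  obtain ⟨i, j, hi, hj, h1, h2, h3⟩ := hG η hη A B (LinearMap.range k.toLinearMap)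
    (LinearMap.range l.toLinearMap) S hS hm
    (e₀.comp k.equivRange.symm.toLinearIsometry) (e₁.comp l.equivRange.symm.toLinearIsometry) (by
      intro x
      obtain ⟨x, rfl⟩ := k.equivRange.surjective x
      have : (⟨S (k.equivRange x), hm _ (k.equivRange x).2⟩ : LinearMap.range l.toLinearMap)
          = l.equivRange (T x) := Subtype.ext (hkl x)
      rw [this]
      simp [he])
  refine ⟨i, j, hi, hj, fun x => ?_, fun y => ?_, fun a => ?_⟩
  · have := ContinuousLinearMap.le_of_opNorm_le _ h1.le (k.equivRange x)
    simpa using this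
  · have := ContinuousLinearMap.le_of_opNorm_le _ h2.le (l.equivRange y)
    simpa using this
  · simpa using ContinuousLinearMap.le_of_opNorm_le _ h3.le a

/-- The Gurarii property phrased with isometric embeddings, in arbitrary universes. -/
lemma gurarii_embed {U V : Type*} [NormedAddCommGroup U] [NormedSpace ℝ U]
    [NormedAddCommGroup V] [NormedSpace ℝ V] (Ω : U →L[ℝ] V) (hG : HasGurariiProperty Ω)
    (η : ℝ) (hη : 0 < η) (A B : Type*) {X Y : Type*}
    [NormedAddCommGroup A] [NormedSpace ℝ A] [FiniteDimensional ℝ A]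
    [NormedAddCommGroup B] [NormedSpace ℝ B] [FiniteDimensional ℝ B]
    [NormedAddCommGroup X] [NormedSpace ℝ X] [NormedAddCommGroup Y] [NormedSpace ℝ Y]
    (S : A →L[ℝ] B) (hS : ∀ a, ‖S a‖ ≤ ‖a‖) (T : X →L[ℝ] Y)
    (k : X →ₗᵢ[ℝ] A) (l : Y →ₗᵢ[ℝ] B) (hkl : ∀ x, S (k x) = l (T x))
    (e₀ : X →ₗᵢ[ℝ] U) (e₁ : Y →ₗᵢ[ℝ] V) (he : ∀ x, Ω (e₀ x) = e₁ (T x)) :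
    ∃ (i : A →L[ℝ] U) (j : B →L[ℝ] V), IsEpsIsometry η i ∧ IsEpsIsometry η j ∧
      (∀ x, ‖i (k x) - e₀ x‖ ≤ η * ‖x‖) ∧ (∀ y, ‖j (l y) - e₁ y‖ ≤ η * ‖y‖) ∧
      ∀ a, ‖Ω (i a) - j (S a)‖ ≤ η * ‖a‖ := by
  obtain ⟨A', _, _, _, ⟨LA⟩⟩ := exists_small_copy A
  obtain ⟨B', _, _, _, ⟨LB⟩⟩ := exists_small_copy B
  let cA : A' →L[ℝ] A := LA.toLinearIsometry.toContinuousLinearMap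
  let cA' : A →L[ℝ] A' := LA.symm.toLinearIsometry.toContinuousLinearMap
  let cB' : B →L[ℝ] B' := LB.symm.toLinearIsometry.toContinuousLinearMap
  obtain ⟨i, j, hi, hj, h1, h2, h3⟩ := gurarii_embed_small Ω hG η hη A' B'
    (cB'.comp (S.comp cA)) (ContinuousLinearMap.opNorm_le_bound _ zero_le_one (by
      intro a
      have := hS (LA a)
      simpa [cA, cB'] using this)) T
    (LA.symm.toLinearIsometry.comp k) (LB.symm.toLinearIsometry.comp l)
    (by intro x; simp [cA, cB', hkl]) e₀ e₁ he
  refine ⟨i.comp cA', j.comp cB', fun a => ?_, fun b => ?_, fun x => h1 x, fun y => h2 y,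
    fun a => ?_⟩
  · simpa [cA'] using hi (LA.symm a)
  · simpa [cB'] using hj (LB.symm b)
  · simpa [cA, cA', cB'] using h3 (LA.symm a)

/-- Claim used in the back-and-forth argument: if `f = (f₀, f₁)` is an `ε`-embedding of
the operator `T` into `R` and `e = (e₀, e₁)` is an embedding of `T` into `Ω` (with `T, R`
acting between finite-dimensional spaces), then for every `δ > 0` there is a
`δ`-embedding `g = (g₀, g₁)` of `R` into `Ω` such that `g ∘ f` is `(2ε + δ)`-close
to `e`. -/
theorem exists_almost_embedding_correcting
    {U V : Type*} [NormedAddCommGroup U] [NormedSpace ℝ U] [CompleteSpace U]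
    [NormedAddCommGroup V] [NormedSpace ℝ V] [CompleteSpace V]
    (Ω : U →L[ℝ] V) (hΩ : ‖Ω‖ ≤ 1) (hG : HasGurariiProperty Ω)
    (ε : ℝ) (hε : 0 < ε)
    {X₀ Y₀ X₁ Y₁ : Type*}
    [NormedAddCommGroup X₀] [NormedSpace ℝ X₀] [FiniteDimensional ℝ X₀]
    [NormedAddCommGroup Y₀] [NormedSpace ℝ Y₀] [FiniteDimensional ℝ Y₀]
    [NormedAddCommGroup X₁] [NormedSpace ℝ X₁] [FiniteDimensional ℝ X₁]
    [NormedAddCommGroup Y₁] [NormedSpace ℝ Y₁] [FiniteDimensional ℝ Y₁]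
    (T : X₀ →L[ℝ] Y₀) (hT : ‖T‖ ≤ 1) (R : X₁ →L[ℝ] Y₁) (hR : ‖R‖ ≤ 1)
    (f₀ : X₀ →L[ℝ] X₁) (f₁ : Y₀ →L[ℝ] Y₁)
    (hf₀ : IsEpsIsometry ε f₀) (hf₁ : IsEpsIsometry ε f₁)
    (hf : ‖R.comp f₀ - f₁.comp T‖ ≤ ε)
    (e₀ : X₀ →ₗᵢ[ℝ] U) (e₁ : Y₀ →ₗᵢ[ℝ] V)
    (he : ∀ x : X₀, Ω (e₀ x) = e₁ (T x))
    (δ : ℝ) (hδ : 0 < δ) :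
    ∃ (g₀ : X₁ →L[ℝ] U) (g₁ : Y₁ →L[ℝ] V),
      IsEpsIsometry δ g₀ ∧ IsEpsIsometry δ g₁ ∧
      ‖Ω.comp g₀ - g₁.comp R‖ ≤ δ ∧
      ‖g₀.comp f₀ - e₀.toContinuousLinearMap‖ ≤ 2 * ε + δ ∧
      ‖g₁.comp f₁ - e₁.toContinuousLinearMap‖ ≤ 2 * ε + δ := by
  have near : ∀ s : ℝ, 0 ≤ s → s ≤ (1 + ε)⁻¹ * s + ε * s := by
    intro s hs
    have h1 : 1 ≤ (1 + ε)⁻¹ + ε := by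
      have h2 : (1 + ε) * (1 + ε)⁻¹ = 1 := mul_inv_cancel₀ (by positivity)
      have h3 : 0 < (1 + ε)⁻¹ := by positivity
      have h4 : (1 + ε)⁻¹ ≤ 1 := inv_le_one_of_one_le₀ (by linarith)
      nlinarith
    nlinarith
  obtain ⟨A, _, _, _, k₀, k₁, hk, hAdec, hAuniv⟩ := exists_amalgam f₀ (2 * ε) (by positivity)
    (fun x => (hf₀ x).2) (fun x => by
      have h1 := near ‖x‖ (norm_nonneg x)
      have h2 := (hf₀ x).1
      have h3 : 0 ≤ ε * ‖x‖ := by positivity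
      linarith)
  obtain ⟨B, _, _, _, l₀, l₁, hl, -, -⟩ := exists_amalgam.{_, _, 0} f₁ ε hε
    (fun x => (hf₁ x).2) (fun x => by
      have h1 := near ‖x‖ (norm_nonneg x)
      have h2 := (hf₁ x).1
      linarith)
  obtain ⟨S, hS₀, hS₁⟩ := hAuniv B (l₀.toLinearMap ∘ₗ T.toLinearMap)
    (l₁.toLinearMap ∘ₗ R.toLinearMap)
  replace hS₀ : ∀ x, S (k₀ x) = l₀ (T x) := hS₀
  replace hS₁ : ∀ x, S (k₁ x) = l₁ (R x) := hS₁
  have hTn : ∀ x, ‖T x‖ ≤ ‖x‖ := fun x => by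
    simpa using T.le_of_opNorm_le hT x
  have hRn : ∀ x, ‖R x‖ ≤ ‖x‖ := fun x => by
    simpa using R.le_of_opNorm_le hR x
  have hfn : ∀ x, ‖R (f₀ x) - f₁ (T x)‖ ≤ ε * ‖x‖ := fun x => by
    simpa using ContinuousLinearMap.le_of_opNorm_le _ hf x
  have hSn : ∀ a, ‖S a‖ ≤ ‖a‖ := by
    intro a
    refine le_of_forall_gt_imp_ge_of_dense fun r hr => ?_
    obtain ⟨u, v, w, rfl, hlt⟩ := hAdec a r hr
    have e : S (k₀ u + k₁ v + (k₀ w - k₁ (f₀ w))) = l₀ (T u) + l₁ (R v) +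
        ((l₀ (T w) - l₁ (f₁ (T w))) - l₁ (R (f₀ w) - f₁ (T w))) := by
      simp only [map_add, map_sub, hS₀, hS₁]; abel
    rw [e]
    have q1 := norm_add_le (l₀ (T u) + l₁ (R v))
      ((l₀ (T w) - l₁ (f₁ (T w))) - l₁ (R (f₀ w) - f₁ (T w)))
    have q2 := norm_add_le (l₀ (T u)) (l₁ (R v))
    have q3 := norm_sub_le (l₀ (T w) - l₁ (f₁ (T w))) (l₁ (R (f₀ w) - f₁ (T w)))
    have q4 := hl (T w)
    have q5 := mul_le_mul_of_nonneg_left (hTn w) hε.le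
    have q6 := hfn w
    have q7 := hTn u
    have q8 := hRn v
    rw [l₁.norm_map] at q3
    rw [l₀.norm_map, l₁.norm_map] at q2
    linarith
  obtain ⟨i, j, hi, hj, h1, h2, h3⟩ := gurarii_embed Ω hG δ hδ A B
    (LinearMap.toContinuousLinearMap S) hSn T k₀ l₀ hS₀ e₀ e₁ he
  refine ⟨i.comp k₁.toContinuousLinearMap, j.comp l₁.toContinuousLinearMap,
    fun x => ?_, fun y => ?_, ?_, ?_, ?_⟩
  · simpa using hi (k₁ x)
  · simpa using hj (l₁ y)
  · refine ContinuousLinearMap.opNorm_le_bound _ hδ.le fun x => ?_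
    simpa [hS₁] using h3 (k₁ x)
  · refine ContinuousLinearMap.opNorm_le_bound _ (by positivity) fun x => ?_
    change ‖i (k₁ (f₀ x)) - e₀ x‖ ≤ _
    have e : i (k₁ (f₀ x)) - e₀ x = (i (k₀ x) - e₀ x) - i (k₀ x - k₁ (f₀ x)) := by
      rw [map_sub]; abel
    rw [e]
    have q1 := norm_sub_le (i (k₀ x) - e₀ x) (i (k₀ x - k₁ (f₀ x)))
    have q2 := (hi (k₀ x - k₁ (f₀ x))).2
    have q3 := hk x
    have q4 := h1 x
    linarith
  · refine ContinuousLinearMap.opNorm_le_bound _ (by positivity) fun x => ?_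
    change ‖j (l₁ (f₁ x)) - e₁ x‖ ≤ _
    have e : j (l₁ (f₁ x)) - e₁ x = (j (l₀ x) - e₁ x) - j (l₀ x - l₁ (f₁ x)) := by
      rw [map_sub]; abel
    rw [e]
    have q1 := norm_sub_le (j (l₀ x) - e₁ x) (j (l₀ x - l₁ (f₁ x)))
    have q2 := (hj (l₀ x - l₁ (f₁ x))).2
    have q3 := hl x
    have q4 := h2 x
    have q5 : 0 ≤ ε * ‖x‖ := by positivity
    linarith
end

section
/- Let Ω: U→V and Ω': U'→V' be nonexpansive linear operators between separable Banach spaces, both with the Gurarii property. Then Ω is isometric to Ω': there exist surjective linear isometries I: U→U' and J: V→V' such that J∘Ω = Ω'∘I. -/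
namespace GurariiAux

/-- Amalgamation seminorm on `W × W'`. -/
noncomputable def amalg {C W W' : Type*} [AddCommGroup C] [Module ℝ C]
    [NormedAddCommGroup W] [NormedSpace ℝ W] [NormedAddCommGroup W'] [NormedSpace ℝ W']
    (L : C →ₗ[ℝ] W) (L' : C →ₗ[ℝ] W') (q : Seminorm ℝ C) : Seminorm ℝ (W × W') :=
  Seminorm.ofSMulLE (fun x => ⨅ c, (‖x.1 - L c‖ + ‖x.2 + L' c‖ + q c))
    (by
      apply le_antisymm
      · refine (ciInf_le ⟨0, ?_⟩ 0).trans (by simp)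
        rintro _ ⟨c, rfl⟩
        have := apply_nonneg q c
        positivity
      · refine le_ciInf fun c => ?_
        have := apply_nonneg q c
        positivity)
    (by
      intro x y
      refine le_of_forall_pos_le_add fun η hη => ?_
      obtain ⟨c, hc⟩ := exists_lt_of_ciInf_lt
        (lt_add_of_pos_right (⨅ c, (‖x.1 - L c‖ + ‖x.2 + L' c‖ + q c)) (half_pos hη))
      obtain ⟨d, hd⟩ := exists_lt_of_ciInf_lt
        (lt_add_of_pos_right (⨅ c, (‖y.1 - L c‖ + ‖y.2 + L' c‖ + q c)) (half_pos hη))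
      have h1 : ‖(x + y).1 - L (c + d)‖ ≤ ‖x.1 - L c‖ + ‖y.1 - L d‖ := by
        have : (x + y).1 - L (c + d) = (x.1 - L c) + (y.1 - L d) := by simp; abel
        rw [this]; exact norm_add_le _ _
      have h2 : ‖(x + y).2 + L' (c + d)‖ ≤ ‖x.2 + L' c‖ + ‖y.2 + L' d‖ := by
        have : (x + y).2 + L' (c + d) = (x.2 + L' c) + (y.2 + L' d) := by simp; abel
        rw [this]; exact norm_add_le _ _
      have h3 := map_add_le_add q c d
      refine (ciInf_le ⟨0, ?_⟩ (c + d)).trans (by linarith)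
      rintro _ ⟨c, rfl⟩
      have := apply_nonneg q c
      positivity)
    (by
      intro r x
      rw [Real.mul_iInf_of_nonneg (norm_nonneg r)]
      refine le_ciInf fun c => ?_
      refine (ciInf_le ⟨0, ?_⟩ (r • c)).trans (le_of_eq ?_)
      · rintro _ ⟨c, rfl⟩
        have := apply_nonneg q c
        positivity
      · simp only [Prod.smul_fst, Prod.smul_snd, map_smul, ← smul_sub, ← smul_add, norm_smul,
          map_smul_eq_mul]
        ring)

section amalg
variable {C W W' : Type*} [AddCommGroup C] [Module ℝ C]
    [NormedAddCommGroup W] [NormedSpace ℝ W] [NormedAddCommGroup W'] [NormedSpace ℝ W']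
    (L : C →ₗ[ℝ] W) (L' : C →ₗ[ℝ] W') (q : Seminorm ℝ C)

lemma amalg_apply (x : W × W') :
    amalg L L' q x = ⨅ c, (‖x.1 - L c‖ + ‖x.2 + L' c‖ + q c) := rfl

lemma amalg_le (x : W × W') (c : C) :
    amalg L L' q x ≤ ‖x.1 - L c‖ + ‖x.2 + L' c‖ + q c := by
  refine ciInf_le (f := fun c => ‖x.1 - L c‖ + ‖x.2 + L' c‖ + q c) ⟨0, ?_⟩ c
  rintro _ ⟨c, rfl⟩
  have := apply_nonneg q c
  positivity

lemma amalg_inl (h : ∀ c, |‖L c‖ - ‖L' c‖| ≤ q c) (w : W) : amalg L L' q (w, 0) = ‖w‖ := by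
  apply le_antisymm
  · simpa using amalg_le L L' q (w, 0) 0
  · rw [amalg_apply]
    refine le_ciInf fun c => ?_
    have h1 := (abs_le.1 (h c)).2
    have h2 : ‖w‖ ≤ ‖w - L c‖ + ‖L c‖ := by simpa using norm_add_le (w - L c) (L c)
    simp only [zero_add]
    linarith

lemma amalg_inr (h : ∀ c, |‖L c‖ - ‖L' c‖| ≤ q c) (w : W') : amalg L L' q (0, w) = ‖w‖ := by
  apply le_antisymm
  · simpa using amalg_le L L' q (0, w) 0
  · rw [amalg_apply]
    refine le_ciInf fun c => ?_
    have h1 := (abs_le.1 (h c)).1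
    have h2 : ‖w‖ ≤ ‖w + L' c‖ + ‖L' c‖ := by simpa using norm_sub_le (w + L' c) (L' c)
    simp only [zero_sub, norm_neg]
    linarith

lemma amalg_glue (c : C) : amalg L L' q (L c, - L' c) ≤ q c := by
  simpa using amalg_le L L' q (L c, - L' c) c

end amalg

/-- quotient of a finite-dimensional seminormed space -/
lemma exists_quot {X : Type} [AddCommGroup X] [Module ℝ X] [FiniteDimensional ℝ X]
    (p : Seminorm ℝ X) :
    ∃ (S : Type) (_ : NormedAddCommGroup S) (_ : NormedSpace ℝ S) (_ : FiniteDimensional ℝ S)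
      (e : X →ₗ[ℝ] S), Function.Surjective e ∧ ∀ x, ‖e x‖ = p x := by
  let i1 : SeminormedAddCommGroup X := p.toAddGroupSeminorm.toSeminormedAddCommGroup
  let i2 : NormedSpace ℝ X := ⟨fun r x => (map_smul_eq_mul p r x).le⟩
  have hs : Function.Surjective (SeparationQuotient.mkCLM ℝ X).toLinearMap :=
    SeparationQuotient.surjective_mk
  refine ⟨SeparationQuotient X, inferInstance, inferInstance, ?_,
    (SeparationQuotient.mkCLM ℝ X).toLinearMap, hs, fun x => rfl⟩
  exact Module.Finite.of_surjective _ hs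

lemma exists_restrict {X S U : Type*} [AddCommGroup X] [Module ℝ X]
    [NormedAddCommGroup S] [NormedSpace ℝ S] [NormedAddCommGroup U] [NormedSpace ℝ U]
    (p : Seminorm ℝ X) (e : X →ₗ[ℝ] S) (he : ∀ x, ‖e x‖ = p x) (X₀ : Submodule ℝ X)
    (i : X →ₗ[ℝ] U) (hi : ∀ x ∈ X₀, ‖i x‖ = p x) :
    ∃ k : X₀.map e →ₗᵢ[ℝ] U, ∀ x (hx : x ∈ X₀), k ⟨e x, Submodule.mem_map_of_mem hx⟩ = i x := by
  have hsurj : Function.Surjective (e.submoduleMap X₀) := e.submoduleMap_surjective X₀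
  obtain ⟨s, hs⟩ := (e.submoduleMap X₀).exists_rightInverse_of_surjective
    (LinearMap.range_eq_top.2 hsurj)
  have hs' : ∀ y, e (s y) = y := fun y => by
    have := congrArg Subtype.val (LinearMap.congr_fun hs y)
    simpa using this
  refine ⟨⟨i.comp (X₀.subtype.comp s), fun y => ?_⟩, fun x hx => ?_⟩
  · have : ‖i (s y)‖ = ‖(y : S)‖ := by rw [hi _ (s y).2, ← he, hs']
    simpa using this
  · have h1 : ‖i ((s ⟨e x, Submodule.mem_map_of_mem hx⟩ : X) - x)‖ = 0 := by
      rw [hi _ (X₀.sub_mem (s _).2 hx), ← he, map_sub, hs']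
      simp
    rw [norm_eq_zero, map_sub, sub_eq_zero] at h1
    exact h1

lemma gurarii_seminorm {U V : Type*} [NormedAddCommGroup U] [NormedSpace ℝ U]
    [NormedAddCommGroup V] [NormedSpace ℝ V] {Ω : U →L[ℝ] V} (hG : HasGurariiProperty Ω)
    {ε : ℝ} (hε : 0 < ε) {X Y : Type} [AddCommGroup X] [Module ℝ X] [FiniteDimensional ℝ X]
    [AddCommGroup Y] [Module ℝ Y] [FiniteDimensional ℝ Y]
    (p : Seminorm ℝ X) (r : Seminorm ℝ Y) (T : X →ₗ[ℝ] Y) (hT : ∀ x, r (T x) ≤ p x)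
    (X₀ : Submodule ℝ X) (Y₀ : Submodule ℝ Y) (hXY : ∀ x ∈ X₀, T x ∈ Y₀)
    (i : X →ₗ[ℝ] U) (j : Y →ₗ[ℝ] V) (hi : ∀ x ∈ X₀, ‖i x‖ = p x) (hj : ∀ y ∈ Y₀, ‖j y‖ = r y)
    (hij : ∀ x ∈ X₀, Ω (i x) = j (T x)) :
    ∃ (i' : X →ₗ[ℝ] U) (j' : Y →ₗ[ℝ] V),
      (∀ x, (1 + ε)⁻¹ * p x ≤ ‖i' x‖ ∧ ‖i' x‖ ≤ p x) ∧
      (∀ y, (1 + ε)⁻¹ * r y ≤ ‖j' y‖ ∧ ‖j' y‖ ≤ r y) ∧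
      (∀ x ∈ X₀, ‖i' x - i x‖ ≤ ε * p x) ∧
      (∀ y ∈ Y₀, ‖j' y - j y‖ ≤ ε * r y) ∧
      (∀ x, ‖Ω (i' x) - j' (T x)‖ ≤ ε * p x) := by
  obtain ⟨S, _, _, _, e, hes, he⟩ := exists_quot p
  obtain ⟨R, _, _, _, f, hfs, hf⟩ := exists_quot r
  obtain ⟨k, hk⟩ := exists_restrict p e he X₀ i hi
  obtain ⟨l, hl⟩ := exists_restrict r f hf Y₀ j hj
  obtain ⟨s, hs⟩ := e.exists_rightInverse_of_surjective (LinearMap.range_eq_top.2 hes)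
  have hs' : ∀ y, e (s y) = y := fun y => LinearMap.congr_fun hs y
  let T' : S →L[ℝ] R := LinearMap.toContinuousLinearMap (f.comp (T.comp s))
  have hT' : ∀ x, T' (e x) = f (T x) := by
    intro x
    change f (T (s (e x))) = f (T x)
    rw [← sub_eq_zero, ← map_sub, ← map_sub, ← norm_le_zero_iff, hf]
    refine (hT _).trans ?_
    rw [← he, map_sub, hs']; simp
  have hTn : ‖T'‖ ≤ 1 := by
    refine ContinuousLinearMap.opNorm_le_bound _ zero_le_one fun y => ?_
    obtain ⟨x, rfl⟩ := hes y
    rw [hT', hf, he, one_mul]; exact hT x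
  have hmem : ∀ x ∈ X₀.map e, T' x ∈ Y₀.map f := by
    rintro _ ⟨x, hx, rfl⟩
    rw [hT']
    exact Submodule.mem_map_of_mem (hXY x hx)
  obtain ⟨i', j', h1, h2, h3, h4, h5⟩ := hG ε hε S R (X₀.map e) (Y₀.map f) T' hTn hmem k l (by
    rintro ⟨_, x, hx, rfl⟩
    have h1 := hk x hx
    have h2 := hl (T x) (hXY x hx)
    simp only [hT']
    rw [h2, ← hij x hx, ← h1])
  refine ⟨i'.toLinearMap.comp e, j'.toLinearMap.comp f, fun x => ?_, fun y => ?_, fun x hx => ?_,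
    fun y hy => ?_, fun x => ?_⟩
  · rw [← he]; exact h1 (e x)
  · rw [← hf]; exact h2 (f y)
  · have := ContinuousLinearMap.le_of_opNorm_le _ h3.le ⟨e x, Submodule.mem_map_of_mem hx⟩
    rw [← he, ← hk x hx]; exact this
  · have := ContinuousLinearMap.le_of_opNorm_le _ h4.le ⟨f y, Submodule.mem_map_of_mem hy⟩
    rw [← hf, ← hl y hy]; exact this
  · have := ContinuousLinearMap.le_of_opNorm_le _ h5.le (e x)
    rw [← he]
    simpa [hT'] using this

lemma exists_extend {M U U' : Type*} [AddCommGroup M] [Module ℝ M]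
    [NormedAddCommGroup U] [NormedSpace ℝ U] [CompleteSpace U]
    [NormedAddCommGroup U'] [NormedSpace ℝ U'] [CompleteSpace U']
    (f : M →ₗ[ℝ] U) (g : M →ₗ[ℝ] U') (h : ∀ m, ‖f m‖ = ‖g m‖) (hf : DenseRange f)
    (hg : DenseRange g) :
    ∃ I : U →ₗᵢ[ℝ] U', Function.Surjective I ∧ ∀ m, I (f m) = g m := by
  have key : ∀ m, g.extendOfNorm f (f m) = g m := fun m =>
    LinearMap.extendOfNorm_eq hf ⟨1, fun x => by rw [h, one_mul]⟩ m
  let I : U →ₗᵢ[ℝ] U' := ⟨(g.extendOfNorm f).toLinearMap, fun x => by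
    refine hf.induction_on x (isClosed_eq ?_ continuous_norm) fun m => ?_
    · exact (g.extendOfNorm f).continuous.norm
    · exact (congrArg norm (key m)).trans (h m).symm⟩
  refine ⟨I, ?_, key⟩
  have hc : IsClosed (Set.range I) := I.isometry.isClosedEmbedding.isClosed_range
  rw [← Set.range_eq_univ, ← hc.closure_eq]
  refine Dense.closure_eq (hg.mono ?_)
  rintro _ ⟨m, rfl⟩
  exact ⟨f m, key m⟩

/-- weighted `ℓ¹` seminorm -/
noncomputable def l1 (ι : Type) [Fintype ι] (ε : ℝ) (hε : 0 ≤ ε) : Seminorm ℝ (ι → ℝ) :=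
  Seminorm.of (fun c => ε * ∑ i, |c i|)
    (by
      intro x y
      rw [← mul_add, ← Finset.sum_add_distrib]
      gcongr with i
      exact abs_add_le _ _)
    (by
      intro r x
      simp only [Pi.smul_apply, smul_eq_mul, abs_mul, ← Finset.mul_sum, Real.norm_eq_abs]
      ring)

lemma l1_apply (ι : Type) [Fintype ι] (ε : ℝ) (hε : 0 ≤ ε) (c : ι → ℝ) :
    l1 ι ε hε c = ε * ∑ i, |c i| := rfl

lemma comb_norm_le {ι U : Type*} [Fintype ι] [NormedAddCommGroup U] [NormedSpace ℝ U]
    (a : ι → U) (M : ℝ) (h : ∀ i, ‖a i‖ ≤ M) (c : ι → ℝ) :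
    ‖Fintype.linearCombination ℝ a c‖ ≤ M * ∑ i, |c i| := by
  rw [Fintype.linearCombination_apply, Finset.mul_sum]
  refine norm_sum_le_of_le _ fun i _ => ?_
  rw [norm_smul, Real.norm_eq_abs, mul_comm]
  exact mul_le_mul_of_nonneg_right (h i) (abs_nonneg _)

lemma comb_single {κ W : Type*} [Fintype κ] [DecidableEq κ] [AddCommGroup W] [Module ℝ W]
    (φ : (κ → ℝ) →ₗ[ℝ] W) (c : κ → ℝ) :
    Fintype.linearCombination ℝ (fun k => φ (Pi.single k 1)) c = φ c := by
  have : Fintype.linearCombination ℝ (fun k => φ (Pi.single k 1)) = φ := by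
    ext k
    simp
  rw [this]

section step
variable {U V U' V' : Type*}
    [NormedAddCommGroup U] [NormedSpace ℝ U] [NormedAddCommGroup V] [NormedSpace ℝ V]
    [NormedAddCommGroup U'] [NormedSpace ℝ U'] [NormedAddCommGroup V'] [NormedSpace ℝ V']

noncomputable def combV {ι : Type} [Fintype ι] (Ω : U →L[ℝ] V) (a : ι → U) (b : ι → V) :
    (ι → ℝ) × (ι → ℝ) →ₗ[ℝ] V :=
  (Ω.toLinearMap.comp (Fintype.linearCombination ℝ a)).coprod (Fintype.linearCombination ℝ b)

lemma combV_apply {ι : Type} [Fintype ι] (Ω : U →L[ℝ] V) (a : ι → U) (b : ι → V)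
    (x : (ι → ℝ) × (ι → ℝ)) : combV Ω a b x =
      Ω (Fintype.linearCombination ℝ a x.1) + Fintype.linearCombination ℝ b x.2 := rfl

/-- Approximate equality of types. -/
def Approx {ι : Type} [Fintype ι] (Ω : U →L[ℝ] V) (Ω' : U' →L[ℝ] V')
    (a : ι → U) (b : ι → V) (a' : ι → U') (b' : ι → V') (ε : ℝ) : Prop :=
  (∀ c, |‖Fintype.linearCombination ℝ a c‖ - ‖Fintype.linearCombination ℝ a' c‖|
      ≤ ε * ∑ i, |c i|) ∧
  ∀ x, |‖combV Ω a b x‖ - ‖combV Ω' a' b' x‖| ≤ ε * ∑ i, |x.1 i| + ε * ∑ i, |x.2 i|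

lemma Approx.symm {ι : Type} [Fintype ι] {Ω : U →L[ℝ] V} {Ω' : U' →L[ℝ] V'}
    {a : ι → U} {b : ι → V} {a' : ι → U'} {b' : ι → V'} {ε : ℝ}
    (h : Approx Ω Ω' a b a' b' ε) : Approx Ω' Ω a' b' a b ε :=
  ⟨fun c => by rw [abs_sub_comm]; exact h.1 c, fun c => by rw [abs_sub_comm]; exact h.2 c⟩

lemma eps_close {δ s t : ℝ} (hδ : 0 < δ) (hs : 0 ≤ s) (h1 : (1 + δ)⁻¹ * s ≤ t) (h2 : t ≤ s) :
    |s - t| ≤ δ * s := by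
  rw [abs_of_nonneg (by linarith)]
  have : 1 - δ ≤ (1 + δ)⁻¹ := by
    rw [← one_div, le_div_iff₀ (by linarith)]
    nlinarith
  nlinarith

lemma step {ι κ : Type} [Fintype ι] [Fintype κ] {Ω : U →L[ℝ] V} {Ω' : U' →L[ℝ] V'}
    (hΩ : ‖Ω‖ ≤ 1) (hΩ' : ‖Ω'‖ ≤ 1) (hG' : HasGurariiProperty Ω')
    {a : ι → U} {b : ι → V} {a' : ι → U'} {b' : ι → V'} {ε δ : ℝ} (hε : 0 < ε) (hδ : 0 < δ)
    (h : Approx Ω Ω' a b a' b' ε) (f : ι → κ) (a₁ : κ → U) (b₁ : κ → V)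
    (ha : ∀ i, a₁ (f i) = a i) (hb : ∀ i, b₁ (f i) = b i) :
    ∃ (a₁' : κ → U') (b₁' : κ → V'), Approx Ω Ω' a₁ b₁ a₁' b₁' δ ∧
      (∀ i, ‖a₁' (f i) - a' i‖ ≤ 2 * ε) ∧ (∀ i, ‖b₁' (f i) - b' i‖ ≤ 2 * ε) := by
  classical
  have hle : ∀ x, ‖Ω x‖ ≤ ‖x‖ := fun x => by
    simpa using ContinuousLinearMap.le_of_opNorm_le _ hΩ x
  have hle' : ∀ x, ‖Ω' x‖ ≤ ‖x‖ := fun x => by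
    simpa using ContinuousLinearMap.le_of_opNorm_le _ hΩ' x
  obtain ⟨M, hM0, hMa, hMb, hMa', hMb'⟩ : ∃ M : ℝ, 0 < M ∧ (∀ k, ‖a₁ k‖ ≤ M) ∧
      (∀ k, ‖b₁ k‖ ≤ M) ∧ (∀ k, ‖a' k‖ ≤ M) ∧ (∀ k, ‖b' k‖ ≤ M) := by
    have p1 : 0 ≤ ∑ k, ‖a₁ k‖ := Finset.sum_nonneg fun _ _ => norm_nonneg _
    have p2 : 0 ≤ ∑ k, ‖b₁ k‖ := Finset.sum_nonneg fun _ _ => norm_nonneg _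
    have p3 : 0 ≤ ∑ k, ‖a' k‖ := Finset.sum_nonneg fun _ _ => norm_nonneg _
    have p4 : 0 ≤ ∑ k, ‖b' k‖ := Finset.sum_nonneg fun _ _ => norm_nonneg _
    refine ⟨∑ k, ‖a₁ k‖ + ∑ k, ‖b₁ k‖ + ∑ k, ‖a' k‖ + ∑ k, ‖b' k‖ + 1, by positivity, ?_, ?_, ?_, ?_⟩
    · intro k
      have := Finset.single_le_sum (f := fun k => ‖a₁ k‖) (fun _ _ => norm_nonneg _)
        (Finset.mem_univ k)
      linarith
    · intro k
      have := Finset.single_le_sum (f := fun k => ‖b₁ k‖) (fun _ _ => norm_nonneg _)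
        (Finset.mem_univ k)
      linarith
    · intro k
      have := Finset.single_le_sum (f := fun k => ‖a' k‖) (fun _ _ => norm_nonneg _)
        (Finset.mem_univ k)
      linarith
    · intro k
      have := Finset.single_le_sum (f := fun k => ‖b' k‖) (fun _ _ => norm_nonneg _)
        (Finset.mem_univ k)
      linarith
  obtain ⟨η, hη, hηδ, hηε⟩ : ∃ η : ℝ, 0 < η ∧ η * M * 2 ≤ δ ∧ η * M ≤ ε := by
    refine ⟨min δ ε / (2 * M), by positivity, ?_, ?_⟩
    · have : min δ ε / (2 * M) * M * 2 = min δ ε := by field_simp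
      rw [this]; exact min_le_left _ _
    · have : min δ ε / (2 * M) * M = min δ ε / 2 := by field_simp
      rw [this]; have := min_le_right δ ε; linarith
  let LU := Fintype.linearCombination ℝ a
  let LU' := Fintype.linearCombination ℝ a'
  let LV := combV Ω a b
  let LV' := combV Ω' a' b'
  let qU : Seminorm ℝ (ι → ℝ) := l1 ι ε hε.le
  let qV : Seminorm ℝ ((ι → ℝ) × (ι → ℝ)) :=
    qU.comp (LinearMap.fst ℝ _ _) + qU.comp (LinearMap.snd ℝ _ _)
  let NU := amalg LU LU' qU
  let NV := amalg LV LV' qV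
  have hU : ∀ c, |‖LU c‖ - ‖LU' c‖| ≤ qU c := h.1
  have hV : ∀ c, |‖LV c‖ - ‖LV' c‖| ≤ qV c := h.2
  let p : Seminorm ℝ ((κ → ℝ) × (ι → ℝ)) :=
    NU.comp ((Fintype.linearCombination ℝ a₁).prodMap LU')
  let r : Seminorm ℝ (((κ → ℝ) × (κ → ℝ)) × ((ι → ℝ) × (ι → ℝ))) :=
    NV.comp ((combV Ω a₁ b₁).prodMap LV')
  let T : ((κ → ℝ) × (ι → ℝ)) →ₗ[ℝ] (((κ → ℝ) × (κ → ℝ)) × ((ι → ℝ) × (ι → ℝ))) :=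
    (LinearMap.inl ℝ _ _).prodMap (LinearMap.inl ℝ _ _)
  have hp : ∀ x, p x = NU (Fintype.linearCombination ℝ a₁ x.1, LU' x.2) := fun x => rfl
  have hr : ∀ x, r x = NV (combV Ω a₁ b₁ x.1, LV' x.2) := fun x => rfl
  have hTx : ∀ x, T x = ((x.1, 0), (x.2, 0)) := fun x => rfl
  have hN : ∀ x : U × U', NV (Ω x.1, Ω' x.2) ≤ NU x := by
    intro x
    refine le_ciInf fun c => ?_
    refine (amalg_le LV LV' qV _ (c, 0)).trans ?_
    have e1 : LV (c, 0) = Ω (LU c) := by simp [LV, LU, combV_apply]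
    have e2 : LV' (c, 0) = Ω' (LU' c) := by simp [LV', LU', combV_apply]
    have e3 : qV (c, 0) = qU c := by
      change qU c + qU 0 = qU c
      simp
    rw [e1, e2, e3, ← map_sub, ← map_add]
    have := hle (x.1 - LU c)
    have := hle' (x.2 + LU' c)
    linarith
  have hT : ∀ x, r (T x) ≤ p x := by
    intro x
    rw [hr, hp, hTx]
    refine le_trans (le_of_eq ?_) (hN _)
    simp [LV', LU', combV_apply]
  obtain ⟨i', j', h1, h2, h3, h4, h5⟩ := gurarii_seminorm hG' hη p r T hT
    (LinearMap.range (LinearMap.inr ℝ _ _)) (LinearMap.range (LinearMap.inr ℝ _ _))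
    (by rintro _ ⟨x, rfl⟩; exact ⟨(x, 0), rfl⟩)
    (LU'.comp (LinearMap.snd ℝ _ _)) (LV'.comp (LinearMap.snd ℝ _ _))
    (by
      rintro _ ⟨x, rfl⟩
      rw [hp]
      simp only [LinearMap.inr_apply, map_zero]
      exact (amalg_inr LU LU' qU hU _).symm)
    (by
      rintro _ ⟨x, rfl⟩
      rw [hr]
      simp only [LinearMap.inr_apply, map_zero]
      exact (amalg_inr LV LV' qV hV _).symm)
    (by
      rintro _ ⟨x, rfl⟩
      simp [hTx, LV', LU', combV_apply])
  have hpl : ∀ c, p (c, 0) = ‖Fintype.linearCombination ℝ a₁ c‖ := fun c => by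
    rw [hp]; simp only [map_zero]; exact amalg_inl LU LU' qU hU _
  have hrl : ∀ c, r (c, 0) = ‖combV Ω a₁ b₁ c‖ := fun c => by
    rw [hr]; simp only [map_zero]; exact amalg_inl LV LV' qV hV _
  have hpr : ∀ c, p (0, c) = ‖LU' c‖ := fun c => by
    rw [hp]; simp only [map_zero]; exact amalg_inr LU LU' qU hU _
  have hrr : ∀ c, r (0, c) = ‖LV' c‖ := fun c => by
    rw [hr]; simp only [map_zero]; exact amalg_inr LV LV' qV hV _
  have hcA : ∀ c, Fintype.linearCombination ℝ (fun k => i' (Pi.single k 1, 0)) c = i' (c, 0) :=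
    comb_single (i'.comp (LinearMap.inl ℝ _ _))
  have hcB : ∀ d, Fintype.linearCombination ℝ (fun k => j' ((0, Pi.single k 1), 0)) d =
      j' ((0, d), 0) :=
    comb_single (j'.comp ((LinearMap.inl ℝ _ _).comp (LinearMap.inr ℝ _ _)))
  have hpM : ∀ c, p (c, 0) ≤ M * ∑ i, |c i| := fun c => by
    rw [hpl]; exact comb_norm_le _ _ hMa _
  refine ⟨fun k => i' (Pi.single k 1, 0), fun k => j' ((0, Pi.single k 1), 0), ⟨fun c => ?_,
    fun x => ?_⟩, fun i => ?_, fun i => ?_⟩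
  · rw [hcA, abs_sub_comm, abs_sub_comm, ← hpl]
    refine (eps_close hη (apply_nonneg p _) (h1 _).1 (h1 _).2).trans ?_
    have := mul_le_mul_of_nonneg_left (hpM c) hη.le
    have h0 : 0 ≤ ∑ i, |c i| := Finset.sum_nonneg fun _ _ => abs_nonneg _
    nlinarith
  · obtain ⟨c, d⟩ := x
    have hcd : combV Ω' (fun k => i' (Pi.single k 1, 0)) (fun k => j' ((0, Pi.single k 1), 0))
        (c, d) = j' ((c, d), 0) + (Ω' (i' (c, 0)) - j' (T (c, 0))) := by
      rw [combV_apply, hcA, hcB]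
      have : (((c, d), 0) : ((κ → ℝ) × (κ → ℝ)) × ((ι → ℝ) × (ι → ℝ))) =
        T (c, 0) + ((0, d), 0) := by simp [hTx]; rfl
      rw [this, map_add]
      abel
    have hc0 : 0 ≤ ∑ i, |c i| := Finset.sum_nonneg fun _ _ => abs_nonneg _
    have hd0 : 0 ≤ ∑ i, |d i| := Finset.sum_nonneg fun _ _ => abs_nonneg _
    have e1 := eps_close hη (apply_nonneg r _) (h2 ((c, d), 0)).1 (h2 ((c, d), 0)).2
    rw [hrl] at e1
    have e2 := h5 (c, 0)
    have e3 : ‖combV Ω a₁ b₁ (c, d)‖ ≤ M * ∑ i, |c i| + M * ∑ i, |d i| := by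
      rw [combV_apply]
      refine (norm_add_le _ _).trans (add_le_add ((hle _).trans ?_) ?_)
      · exact comb_norm_le _ _ hMa _
      · exact comb_norm_le _ _ hMb _
    have e4 : |‖j' ((c, d), 0)‖ - ‖j' ((c, d), 0) + (Ω' (i' (c, 0)) - j' (T (c, 0)))‖| ≤
        ‖Ω' (i' (c, 0)) - j' (T (c, 0))‖ := by
      rw [abs_sub_comm]
      refine (abs_norm_sub_norm_le _ _).trans (le_of_eq ?_)
      rw [add_sub_cancel_left]
    rw [hcd]
    have e5 := abs_sub_le ‖combV Ω a₁ b₁ (c, d)‖ ‖j' ((c, d), 0)‖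
      ‖j' ((c, d), 0) + (Ω' (i' (c, 0)) - j' (T (c, 0)))‖
    have e6 := mul_le_mul_of_nonneg_left (hpM c) hη.le
    have e7 := mul_le_mul_of_nonneg_left e3 hη.le
    have e8 := mul_le_mul_of_nonneg_right hηδ hc0
    have e9 := mul_le_mul_of_nonneg_right hηδ hd0
    have e10 : 0 ≤ η * M * ∑ i, |d i| := by positivity
    simp only
    nlinarith
  · have e1 := h3 (0, Pi.single i 1) ⟨_, rfl⟩
    have e2 := (h1 (Pi.single (f i) 1, - Pi.single i 1)).2
    have e3 : p (Pi.single (f i) 1, - Pi.single i 1) ≤ ε := by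
      have := amalg_glue LU LU' qU (Pi.single i 1)
      have e : qU (Pi.single i 1) = ε := by
        change ε * ∑ k, |(Pi.single i 1 : ι → ℝ) k| = ε
        rw [Finset.sum_eq_single i] <;> simp +contextual
      rw [hp, map_neg]
      rw [e] at this
      convert this using 2
      simp [LU, ha]
    rw [hpr] at e1
    have e4 : ‖LU' (Pi.single i 1)‖ ≤ M := by simpa [LU'] using hMa' i
    have e5 : i' (Pi.single (f i) 1, 0) - a' i = i' (Pi.single (f i) 1, - Pi.single i 1) +
        (i' (0, Pi.single i 1) - (LU' ∘ₗ LinearMap.snd ℝ (κ → ℝ) (ι → ℝ)) (0, Pi.single i 1)) := by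
      rw [← add_sub_assoc, ← map_add]
      simp [LU']
    rw [e5]
    refine (norm_add_le _ _).trans ?_
    have := mul_le_mul_of_nonneg_left e4 hη.le
    linarith
  · have e1 := h4 (0, (0, Pi.single i 1)) ⟨_, rfl⟩
    have e2 := (h2 ((0, Pi.single (f i) 1), - (0, Pi.single i 1))).2
    have e3 : r ((0, Pi.single (f i) 1), - (0, Pi.single i 1)) ≤ ε := by
      have := amalg_glue LV LV' qV (0, Pi.single i 1)
      have e : qV (0, Pi.single i 1) = ε := by
        change ε * ∑ k, |(0 : ι → ℝ) k| + ε * ∑ k, |(Pi.single i 1 : ι → ℝ) k| = ε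
        rw [Finset.sum_eq_single (f := fun k => |(Pi.single i 1 : ι → ℝ) k|) i] <;>
          simp +contextual
      rw [hr, map_neg]
      rw [e] at this
      convert this using 2
      simp [LV, combV_apply, hb]
    rw [hrr] at e1
    change ‖j' (0, (0, Pi.single i 1)) - LV' (0, Pi.single i 1)‖ ≤ _ at e1
    have e4 : ‖LV' (0, Pi.single i 1)‖ ≤ M := by simpa [LV', combV_apply] using hMb' i
    have e5 : j' ((0, Pi.single (f i) 1), 0) - b' i =
        j' ((0, Pi.single (f i) 1), - (0, Pi.single i 1)) +
        (j' (0, (0, Pi.single i 1)) - LV' (0, Pi.single i 1)) := by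
      rw [← add_sub_assoc, ← map_add]
      simp [LV', combV_apply]
      rfl
    rw [e5]
    refine (norm_add_le _ _).trans ?_
    have := mul_le_mul_of_nonneg_left e4 hη.le
    linarith

end step

lemma comb_finsupp {E : Type*} [AddCommGroup E] [Module ℝ E] (a : ℕ → E) (c : ℕ →₀ ℝ) (n : ℕ)
    (h : c.support ⊆ Finset.range n) :
    Fintype.linearCombination ℝ (fun i : Fin n => a i) (fun i => c i) =
      Finsupp.linearCombination ℝ a c := by
  rw [Fintype.linearCombination_apply, Finsupp.linearCombination_apply,
    Finsupp.sum_of_support_subset _ h _ (by simp)]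
  exact Fin.sum_univ_eq_sum_range (fun i => c i • a i) n

lemma abs_finsupp (c : ℕ →₀ ℝ) (n : ℕ) (h : c.support ⊆ Finset.range n) :
    ∑ i : Fin n, |c i| = c.sum (fun _ x => |x|) := by
  rw [Finsupp.sum_of_support_subset _ h _ (by simp)]
  exact Fin.sum_univ_eq_sum_range (fun i => |c i|) n

lemma exists_lim {E : Type*} [NormedAddCommGroup E] [CompleteSpace E] (x : ℕ → ℕ → E)
    (h : ∀ k, ∀ i < 2 * k, ‖x (k + 1) i - x k i‖ ≤ 2 * (1 / 2) ^ k) :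
    ∃ y : ℕ → E, ∀ k, ∀ i < 2 * k, ‖x k i - y i‖ ≤ 4 * (1 / 2) ^ k := by
  have hd : ∀ k i, i < 2 * k → ∀ n, dist (x (n + k) i) (x (n + 1 + k) i) ≤
      2 * (1 / 2) ^ k * (1 / 2) ^ n := by
    intro k i hi n
    rw [dist_comm, dist_eq_norm, show n + 1 + k = n + k + 1 by ring]
    refine (h (n + k) i (by omega)).trans (le_of_eq ?_)
    rw [pow_add]; ring
  have hc : ∀ i, ∃ y, Filter.Tendsto (fun k => x k i) Filter.atTop (nhds y) := by
    intro i
    obtain ⟨y, hy⟩ := cauchySeq_tendsto_of_complete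
      (cauchySeq_of_le_geometric (1 / 2) _ (by norm_num) (hd (i + 1) i (by omega)))
    exact ⟨y, (Filter.tendsto_add_atTop_iff_nat (f := fun k => x k i) (i + 1)).1 hy⟩
  choose y hy using hc
  refine ⟨y, fun k i hi => ?_⟩
  have := dist_le_of_le_geometric_of_tendsto₀ (1 / 2) _ (by norm_num) (hd k i hi)
    ((Filter.tendsto_add_atTop_iff_nat (f := fun k => x k i) k).2 (hy i))
  rw [dist_eq_norm, zero_add] at this
  refine this.trans (le_of_eq ?_)
  ring

lemma dense_of_close {E : Type*} [NormedAddCommGroup E] [TopologicalSpace.SeparableSpace E]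
    (y : ℕ → E) (φ : ℕ → ℕ)
    (h : ∀ k, ‖y (φ k) - TopologicalSpace.denseSeq E (Nat.unpair k).1‖ ≤ 4 * (1 / 2) ^ k) :
    DenseRange y := by
  intro w
  rw [Metric.mem_closure_iff]
  intro η hη
  obtain ⟨m, hm⟩ := (TopologicalSpace.denseRange_denseSeq E).exists_dist_lt w (half_pos hη)
  obtain ⟨t, ht⟩ := exists_pow_lt_of_lt_one (show 0 < η / 8 by positivity)
    (show (1 / 2 : ℝ) < 1 by norm_num)
  refine ⟨_, ⟨φ (Nat.pair m t), rfl⟩, ?_⟩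
  have h1 := h (Nat.pair m t)
  rw [Nat.unpair_pair] at h1
  have h2 : (1 / 2 : ℝ) ^ (Nat.pair m t) ≤ (1 / 2) ^ t :=
    pow_le_pow_of_le_one (by norm_num) (by norm_num) (Nat.right_le_pair m t)
  have h3 := dist_triangle w (TopologicalSpace.denseSeq E m) (y (φ (Nat.pair m t)))
  rw [dist_comm (TopologicalSpace.denseSeq E m), dist_eq_norm (y _)] at h3
  simp only at h1
  linarith

section main
variable {U V U' V' : Type*}
    [NormedAddCommGroup U] [NormedSpace ℝ U] [NormedAddCommGroup V] [NormedSpace ℝ V]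
    [NormedAddCommGroup U'] [NormedSpace ℝ U'] [NormedAddCommGroup V'] [NormedSpace ℝ V']

def Good (Ω : U →L[ℝ] V) (Ω' : U' →L[ℝ] V') (n : ℕ) (ε : ℝ)
    (a : ℕ → U) (b : ℕ → V) (a' : ℕ → U') (b' : ℕ → V') : Prop :=
  Approx Ω Ω' (fun i : Fin n => a i) (fun i : Fin n => b i) (fun i : Fin n => a' i)
    (fun i : Fin n => b' i) ε

lemma fwd {Ω : U →L[ℝ] V} {Ω' : U' →L[ℝ] V'}
    (hΩ : ‖Ω‖ ≤ 1) (hΩ' : ‖Ω'‖ ≤ 1) (hG' : HasGurariiProperty Ω')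
    {a : ℕ → U} {b : ℕ → V} {a' : ℕ → U'} {b' : ℕ → V'} {ε δ : ℝ} (hε : 0 < ε) (hδ : 0 < δ)
    {n : ℕ} (h : Good Ω Ω' n ε a b a' b') (u : U) (v : V) :
    ∃ (A' : ℕ → U') (B' : ℕ → V'),
      Good Ω Ω' (n + 1) δ (Function.update a n u) (Function.update b n v) A' B' ∧
      (∀ i < n, ‖A' i - a' i‖ ≤ 2 * ε) ∧ (∀ i < n, ‖B' i - b' i‖ ≤ 2 * ε) := by
  obtain ⟨A, B, h1, h2, h3⟩ := step hΩ hΩ' hG' hε hδ h (Fin.castSucc : Fin n → Fin (n + 1))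
    (fun i => Function.update a n u i) (fun i => Function.update b n v i)
    (fun i => by simp [i.2.ne]) (fun i => by simp [i.2.ne])
  refine ⟨fun k => if hk : k < n + 1 then A ⟨k, hk⟩ else 0,
    fun k => if hk : k < n + 1 then B ⟨k, hk⟩ else 0, ?_, fun i hi => ?_, fun i hi => ?_⟩
  · unfold Good
    convert h1 using 1
    · funext i; exact dif_pos i.2
    · funext i; exact dif_pos i.2
  · simp only [dif_pos (show i < n + 1 by omega)]
    exact h2 ⟨i, hi⟩
  · simp only [dif_pos (show i < n + 1 by omega)]
    exact h3 ⟨i, hi⟩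

lemma dbl {Ω : U →L[ℝ] V} {Ω' : U' →L[ℝ] V'}
    (hΩ : ‖Ω‖ ≤ 1) (hΩ' : ‖Ω'‖ ≤ 1) (hG : HasGurariiProperty Ω) (hG' : HasGurariiProperty Ω')
    {a : ℕ → U} {b : ℕ → V} {a' : ℕ → U'} {b' : ℕ → V'} {ε δ : ℝ} (hε : 0 < ε) (hδ : 0 < δ)
    {n : ℕ} (h : Good Ω Ω' n ε a b a' b') (u : U) (v : V) (u' : U') (v' : V') :
    ∃ (A : ℕ → U) (B : ℕ → V) (A' : ℕ → U') (B' : ℕ → V'),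
      Good Ω Ω' (n + 2) δ A B A' B' ∧
      (∀ i < n, ‖A i - a i‖ ≤ 2 * ε) ∧ (∀ i < n, ‖B i - b i‖ ≤ 2 * ε) ∧
      (∀ i < n, ‖A' i - a' i‖ ≤ 2 * ε) ∧ (∀ i < n, ‖B' i - b' i‖ ≤ 2 * ε) ∧
      ‖A n - u‖ ≤ 2 * ε ∧ ‖B n - v‖ ≤ 2 * ε ∧ A' (n + 1) = u' ∧ B' (n + 1) = v' := by
  obtain ⟨a1, b1, h1, h2, h3⟩ := fwd hΩ hΩ' hG' hε hε h u v
  obtain ⟨A, B, g1, g2, g3⟩ := fwd hΩ' hΩ hG hε hδ (Approx.symm h1) u' v'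
  refine ⟨A, B, _, _, Approx.symm g1, fun i hi => ?_, fun i hi => ?_, fun i hi => ?_,
    fun i hi => ?_, ?_, ?_, by simp, by simp⟩
  · simpa [hi.ne] using g2 i (by omega)
  · simpa [hi.ne] using g3 i (by omega)
  · simpa [show i ≠ n + 1 by omega] using h2 i hi
  · simpa [show i ≠ n + 1 by omega] using h3 i hi
  · simpa using g2 n (by omega)
  · simpa using g3 n (by omega)

/-- A stage of the back-and-forth construction. -/
structure St (U V U' V' : Type*) where
  a : ℕ → U
  b : ℕ → V
  a' : ℕ → U'
  b' : ℕ → V'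

lemma exists_seq {Ω : U →L[ℝ] V} {Ω' : U' →L[ℝ] V'}
    (hΩ : ‖Ω‖ ≤ 1) (hΩ' : ‖Ω'‖ ≤ 1) (hG : HasGurariiProperty Ω) (hG' : HasGurariiProperty Ω')
    (u : ℕ → U) (v : ℕ → V) (u' : ℕ → U') (v' : ℕ → V') :
    ∃ s : ℕ → St U V U' V', ∀ k,
      Good Ω Ω' (2 * k) ((1 / 2) ^ k) (s k).a (s k).b (s k).a' (s k).b' ∧
      (∀ i < 2 * k, ‖(s (k + 1)).a i - (s k).a i‖ ≤ 2 * (1 / 2) ^ k) ∧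
      (∀ i < 2 * k, ‖(s (k + 1)).b i - (s k).b i‖ ≤ 2 * (1 / 2) ^ k) ∧
      (∀ i < 2 * k, ‖(s (k + 1)).a' i - (s k).a' i‖ ≤ 2 * (1 / 2) ^ k) ∧
      (∀ i < 2 * k, ‖(s (k + 1)).b' i - (s k).b' i‖ ≤ 2 * (1 / 2) ^ k) ∧
      ‖(s (k + 1)).a (2 * k) - u k‖ ≤ 2 * (1 / 2) ^ k ∧
      ‖(s (k + 1)).b (2 * k) - v k‖ ≤ 2 * (1 / 2) ^ k ∧
      (s (k + 1)).a' (2 * k + 1) = u' k ∧ (s (k + 1)).b' (2 * k + 1) = v' k := by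
  have key : ∀ (k : ℕ) (s : St U V U' V'), ∃ t : St U V U' V',
      Good Ω Ω' (2 * k) ((1 / 2) ^ k) s.a s.b s.a' s.b' →
      Good Ω Ω' (2 * (k + 1)) ((1 / 2) ^ (k + 1)) t.a t.b t.a' t.b' ∧
      (∀ i < 2 * k, ‖t.a i - s.a i‖ ≤ 2 * (1 / 2) ^ k) ∧
      (∀ i < 2 * k, ‖t.b i - s.b i‖ ≤ 2 * (1 / 2) ^ k) ∧
      (∀ i < 2 * k, ‖t.a' i - s.a' i‖ ≤ 2 * (1 / 2) ^ k) ∧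
      (∀ i < 2 * k, ‖t.b' i - s.b' i‖ ≤ 2 * (1 / 2) ^ k) ∧
      ‖t.a (2 * k) - u k‖ ≤ 2 * (1 / 2) ^ k ∧
      ‖t.b (2 * k) - v k‖ ≤ 2 * (1 / 2) ^ k ∧
      t.a' (2 * k + 1) = u' k ∧ t.b' (2 * k + 1) = v' k := by
    intro k s
    by_cases h : Good Ω Ω' (2 * k) ((1 / 2) ^ k) s.a s.b s.a' s.b'
    · obtain ⟨A, B, A', B', hh⟩ := dbl hΩ hΩ' hG hG' (by positivity)
        (show (0 : ℝ) < (1 / 2) ^ (k + 1) by positivity) h (u k) (v k) (u' k) (v' k)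
      exact ⟨⟨A, B, A', B'⟩, fun _ => hh⟩
    · exact ⟨s, fun h' => absurd h' h⟩
  choose nxt hn using key
  let s : ℕ → St U V U' V' := fun k =>
    Nat.rec ⟨fun _ => 0, fun _ => 0, fun _ => 0, fun _ => 0⟩ (fun k s => nxt k s) k
  have hg : ∀ k, Good Ω Ω' (2 * k) ((1 / 2) ^ k) (s k).a (s k).b (s k).a' (s k).b' := by
    intro k
    induction k with
    | zero =>
      refine ⟨fun c => ?_, fun x => ?_⟩
      · simp [s, Fintype.linearCombination_apply]
      · simp [s, combV_apply, Fintype.linearCombination_apply]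
    | succ k ih => exact (hn k (s k) ih).1
  exact ⟨s, fun k => ⟨hg k, (hn k (s k) (hg k)).2⟩⟩

lemma tendsto_lc {E : Type*} [NormedAddCommGroup E] [NormedSpace ℝ E] (x : ℕ → ℕ → E) (y : ℕ → E)
    (h : ∀ k, ∀ i < 2 * k, ‖x k i - y i‖ ≤ 4 * (1 / 2) ^ k) (c : ℕ →₀ ℝ) :
    Filter.Tendsto (fun k => Finsupp.linearCombination ℝ (x k) c) Filter.atTop
      (nhds (Finsupp.linearCombination ℝ y c)) := by
  simp only [Finsupp.linearCombination_apply, Finsupp.sum]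
  refine tendsto_finsetSum _ fun i _ => Filter.Tendsto.const_smul ?_ _
  rw [tendsto_iff_norm_sub_tendsto_zero]
  have h0 : Filter.Tendsto (fun k : ℕ => 4 * (1 / 2 : ℝ) ^ k) Filter.atTop (nhds 0) := by
    simpa using (tendsto_pow_atTop_nhds_zero_of_lt_one (r := (1 / 2 : ℝ)) (by norm_num)
      (by norm_num)).const_mul 4
  refine squeeze_zero' (Filter.Eventually.of_forall fun _ => norm_nonneg _) ?_ h0
  filter_upwards [Filter.eventually_ge_atTop (i + 1)] with k hk
  exact h k i (by omega)

lemma dense_lc {E : Type*} [NormedAddCommGroup E] [NormedSpace ℝ E] (y : ℕ → E)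
    (h : DenseRange y) : DenseRange (Finsupp.linearCombination ℝ y) := by
  refine Dense.mono ?_ h
  rintro _ ⟨i, rfl⟩
  exact ⟨Finsupp.single i 1, by simp⟩

lemma main [CompleteSpace U] [TopologicalSpace.SeparableSpace U]
    [CompleteSpace V] [TopologicalSpace.SeparableSpace V]
    [CompleteSpace U'] [TopologicalSpace.SeparableSpace U']
    [CompleteSpace V'] [TopologicalSpace.SeparableSpace V']
    (Ω : U →L[ℝ] V) (Ω' : U' →L[ℝ] V') (hΩ : ‖Ω‖ ≤ 1) (hΩ' : ‖Ω'‖ ≤ 1)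
    (hG : HasGurariiProperty Ω) (hG' : HasGurariiProperty Ω') :
    ∃ (I : U →ₗᵢ[ℝ] U') (J : V →ₗᵢ[ℝ] V'),
      Function.Surjective I ∧ Function.Surjective J ∧
      ∀ x : U, J (Ω x) = Ω' (I x) := by
  obtain ⟨s, hs⟩ := exists_seq hΩ hΩ' hG hG'
    (fun k => TopologicalSpace.denseSeq U (Nat.unpair k).1)
    (fun k => TopologicalSpace.denseSeq V (Nat.unpair k).1)
    (fun k => TopologicalSpace.denseSeq U' (Nat.unpair k).1)
    (fun k => TopologicalSpace.denseSeq V' (Nat.unpair k).1)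
  obtain ⟨a, ha⟩ := exists_lim (fun k => (s k).a) fun k => (hs k).2.1
  obtain ⟨b, hb⟩ := exists_lim (fun k => (s k).b) fun k => (hs k).2.2.1
  obtain ⟨a', ha'⟩ := exists_lim (fun k => (s k).a') fun k => (hs k).2.2.2.1
  obtain ⟨b', hb'⟩ := exists_lim (fun k => (s k).b') fun k => (hs k).2.2.2.2.1
  have da : DenseRange a := dense_of_close a (fun k => 2 * k) fun k => by
    have h1 := (hs k).2.2.2.2.2.1
    have h2 := ha (k + 1) (2 * k) (by omega)
    rw [norm_sub_rev] at h2
    have h3 := norm_sub_le_norm_sub_add_norm_sub (a (2 * k)) ((s (k + 1)).a (2 * k))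
      (TopologicalSpace.denseSeq U (Nat.unpair k).1)
    rw [pow_succ] at h2
    linarith
  have db : DenseRange b := dense_of_close b (fun k => 2 * k) fun k => by
    have h1 := (hs k).2.2.2.2.2.2.1
    have h2 := hb (k + 1) (2 * k) (by omega)
    rw [norm_sub_rev] at h2
    have h3 := norm_sub_le_norm_sub_add_norm_sub (b (2 * k)) ((s (k + 1)).b (2 * k))
      (TopologicalSpace.denseSeq V (Nat.unpair k).1)
    rw [pow_succ] at h2
    linarith
  have da' : DenseRange a' := dense_of_close a' (fun k => 2 * k + 1) fun k => by
    have h1 := (hs k).2.2.2.2.2.2.2.1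
    have h2 := ha' (k + 1) (2 * k + 1) (by omega)
    rw [norm_sub_rev, h1, pow_succ] at h2
    have : (0 : ℝ) < (1 / 2) ^ k := by positivity
    linarith
  have db' : DenseRange b' := dense_of_close b' (fun k => 2 * k + 1) fun k => by
    have h1 := (hs k).2.2.2.2.2.2.2.2
    have h2 := hb' (k + 1) (2 * k + 1) (by omega)
    rw [norm_sub_rev, h1, pow_succ] at h2
    have : (0 : ℝ) < (1 / 2) ^ k := by positivity
    linarith
  have hsupp : ∀ c : ℕ →₀ ℝ, ∀ᶠ k in Filter.atTop, c.support ⊆ Finset.range (2 * k) := by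
    intro c
    obtain ⟨N, hN⟩ := c.support.exists_nat_subset_range
    filter_upwards [Filter.eventually_ge_atTop N] with k hk
    exact hN.trans (Finset.range_subset_range.2 (by omega))
  have h0 : ∀ C : ℝ, Filter.Tendsto (fun k : ℕ => (1 / 2 : ℝ) ^ k * C) Filter.atTop (nhds 0) := by
    intro C
    simpa using (tendsto_pow_atTop_nhds_zero_of_lt_one (r := (1 / 2 : ℝ)) (by norm_num)
      (by norm_num)).mul_const C
  have isoU : ∀ c, ‖Finsupp.linearCombination ℝ a c‖ = ‖Finsupp.linearCombination ℝ a' c‖ := by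
    intro c
    have t := ((tendsto_lc _ _ ha c).norm.sub (tendsto_lc _ _ ha' c).norm).abs
    have := le_of_tendsto_of_tendsto t (h0 (c.sum fun _ x => |x|)) (by
      filter_upwards [hsupp c] with k hk
      have := (hs k).1.1 (fun i => c i)
      rwa [comb_finsupp _ _ _ hk, comb_finsupp _ _ _ hk, abs_finsupp _ _ hk] at this)
    exact sub_eq_zero.1 (abs_nonpos_iff.1 this)
  let F : (ℕ →₀ ℝ) × (ℕ →₀ ℝ) →ₗ[ℝ] V :=
    (Ω.toLinearMap.comp (Finsupp.linearCombination ℝ a)).coprod (Finsupp.linearCombination ℝ b)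
  let F' : (ℕ →₀ ℝ) × (ℕ →₀ ℝ) →ₗ[ℝ] V' :=
    (Ω'.toLinearMap.comp (Finsupp.linearCombination ℝ a')).coprod (Finsupp.linearCombination ℝ b')
  have isoV : ∀ x, ‖F x‖ = ‖F' x‖ := by
    rintro ⟨c, d⟩
    have t := ((((Ω.continuous.tendsto _).comp (tendsto_lc _ _ ha c)).add
      (tendsto_lc _ _ hb d)).norm.sub (((Ω'.continuous.tendsto _).comp (tendsto_lc _ _ ha' c)).add
      (tendsto_lc _ _ hb' d)).norm).abs
    have := le_of_tendsto_of_tendsto t (h0 ((c.sum fun _ x => |x|) + (d.sum fun _ x => |x|))) (by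
      filter_upwards [hsupp c, hsupp d] with k hk hk'
      have := (hs k).1.2 (fun i => c i, fun i => d i)
      rw [combV_apply, combV_apply] at this
      simp only at this
      rwa [comb_finsupp _ _ _ hk, comb_finsupp _ _ _ hk, abs_finsupp _ _ hk,
        comb_finsupp _ _ _ hk', comb_finsupp _ _ _ hk', abs_finsupp _ _ hk', ← mul_add] at this)
    exact sub_eq_zero.1 (abs_nonpos_iff.1 this)
  have dF : DenseRange F := by
    refine Dense.mono ?_ (dense_lc b db)
    rintro _ ⟨d, rfl⟩
    exact ⟨(0, d), by simp [F]⟩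
  have dF' : DenseRange F' := by
    refine Dense.mono ?_ (dense_lc b' db')
    rintro _ ⟨d, rfl⟩
    exact ⟨(0, d), by simp [F']⟩
  obtain ⟨I, hI, hI'⟩ := exists_extend _ _ isoU (dense_lc a da) (dense_lc a' da')
  obtain ⟨J, hJ, hJ'⟩ := exists_extend F F' isoV dF dF'
  refine ⟨I, J, hI, hJ, fun x => ?_⟩
  refine (dense_lc a da).induction_on x (isClosed_eq (J.continuous.comp Ω.continuous)
    (Ω'.continuous.comp I.continuous)) fun c => ?_
  rw [hI']
  have := hJ' (c, 0)
  simpa [F, F'] using this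

end main

end GurariiAux

/-- Uniqueness: any two operators with the Gurarii property between separable Banach
spaces are isometric. -/
theorem Gurarii_operator_unique
    {U V U' V' : Type*}
    [NormedAddCommGroup U] [NormedSpace ℝ U] [CompleteSpace U]
    [TopologicalSpace.SeparableSpace U]
    [NormedAddCommGroup V] [NormedSpace ℝ V] [CompleteSpace V]
    [TopologicalSpace.SeparableSpace V]
    [NormedAddCommGroup U'] [NormedSpace ℝ U'] [CompleteSpace U']
    [TopologicalSpace.SeparableSpace U']
    [NormedAddCommGroup V'] [NormedSpace ℝ V'] [CompleteSpace V']
    [TopologicalSpace.SeparableSpace V']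
    (Ω : U →L[ℝ] V) (Ω' : U' →L[ℝ] V') (hΩ : ‖Ω‖ ≤ 1) (hΩ' : ‖Ω'‖ ≤ 1)
    (hG : HasGurariiProperty Ω) (hG' : HasGurariiProperty Ω') :
    ∃ (I : U →ₗᵢ[ℝ] U') (J : V →ₗᵢ[ℝ] V'),
      Function.Surjective I ∧ Function.Surjective J ∧
      ∀ x : U, J (Ω x) = Ω' (I x) := by
  exact GurariiAux.main Ω Ω' hΩ hΩ' hG hG'
end

section
/- Let Ω: U→V be a nonexpansive linear operator between separable Banach spaces with the Gurarii property. Then Ω is almost homogeneous: given ε>0, finite-dimensional subspaces X₀, X₁ ⊆ U and Y₀, Y₁ ⊆ V with Ω(X₀) ⊆ Y₀ and Ω(X₁) ⊆ Y₁, and linear isometric embeddings i: X₀→X₁, j: Y₀→Y₁ such that Ω(i(x)) = j(Ω(x)) for all x∈X₀, there exist surjective linear isometries I: U→U and J: V→V such that Ω∘I = J∘Ω, ‖I↾X₀ − i‖ ≤ ε and ‖J↾Y₀ − j‖ ≤ ε. -/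
open Filter Topology

section Amalgam

variable {X F : Type*} [NormedAddCommGroup X] [NormedSpace ℝ X]
  [NormedAddCommGroup F] [NormedSpace ℝ F]

/-- The cost of a decomposition. -/
def amCost (φ : X →ₗ[ℝ] F) (c : ℝ) (z : X × F) (w : X) : ℝ :=
  ‖z.1 - w‖ + ‖z.2 + φ w‖ + c * ‖w‖

lemma amCost_nonneg (φ : X →ₗ[ℝ] F) {c : ℝ} (hc : 0 ≤ c) (z : X × F) (w : X) :
    0 ≤ amCost φ c z w := by
  unfold amCost; positivity

lemma amCost_bdd (φ : X →ₗ[ℝ] F) {c : ℝ} (hc : 0 ≤ c) (z : X × F) :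
    BddBelow (Set.range (amCost φ c z)) :=
  ⟨0, by rintro _ ⟨w, rfl⟩; exact amCost_nonneg φ hc z w⟩

/-- The amalgamation norm on `X × F`. -/
noncomputable def amNorm (φ : X →ₗ[ℝ] F) (c : ℝ) (hc : 0 ≤ c) : Seminorm ℝ (X × F) :=
  Seminorm.ofSMulLE (fun z => ⨅ w, amCost φ c z w)
    (by
      apply le_antisymm
      · refine (ciInf_le (amCost_bdd φ hc 0) 0).trans ?_
        simp [amCost]
      · exact le_ciInf fun w => amCost_nonneg φ hc 0 w)
    (by
      intro x y
      refine le_ciInf_add_ciInf fun v w => ?_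
      refine (ciInf_le (amCost_bdd φ hc _) (v + w)).trans ?_
      unfold amCost
      have h1 : (x + y).1 - (v + w) = (x.1 - v) + (y.1 - w) := by
        simp only [Prod.fst_add]; abel
      have h2 : (x + y).2 + φ (v + w) = (x.2 + φ v) + (y.2 + φ w) := by
        simp only [Prod.snd_add, map_add]; abel
      rw [h1, h2]
      have h3 := norm_add_le (x.1 - v) (y.1 - w)
      have h4 := norm_add_le (x.2 + φ v) (y.2 + φ w)
      have h5 := mul_le_mul_of_nonneg_left (norm_add_le v w) hc
      linarith)
    (by
      intro r x
      rw [Real.mul_iInf_of_nonneg (norm_nonneg r)]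
      refine le_ciInf fun w => ?_
      refine (ciInf_le (amCost_bdd φ hc _) (r • w)).trans ?_
      unfold amCost
      have h1 : (r • x).1 - r • w = r • (x.1 - w) := by
        simp [smul_sub]
      have h2 : (r • x).2 + φ (r • w) = r • (x.2 + φ w) := by
        simp [smul_add]
      rw [h1, h2, norm_smul, norm_smul, norm_smul]
      apply le_of_eq; ring)

lemma amNorm_le (φ : X →ₗ[ℝ] F) (c : ℝ) (hc : 0 ≤ c) (z : X × F) (w : X) :
    amNorm φ c hc z ≤ ‖z.1 - w‖ + ‖z.2 + φ w‖ + c * ‖w‖ :=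
  ciInf_le (amCost_bdd φ hc z) w

lemma le_amNorm (φ : X →ₗ[ℝ] F) (c : ℝ) (hc : 0 ≤ c) (z : X × F) (a : ℝ)
    (h : ∀ w, a ≤ ‖z.1 - w‖ + ‖z.2 + φ w‖ + c * ‖w‖) :
    a ≤ amNorm φ c hc z :=
  le_ciInf h

lemma amNorm_left (φ : X →ₗ[ℝ] F) (c : ℝ) (hc : 0 ≤ c)
    (hφ : ∀ x, (1 - c) * ‖x‖ ≤ ‖φ x‖) (x : X) : amNorm φ c hc (x, 0) = ‖x‖ := by
  apply le_antisymm
  · simpa using amNorm_le φ c hc (x, 0) 0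
  · refine le_amNorm φ c hc _ _ fun w => ?_
    have h1 := norm_sub_norm_le x w
    have h2 := hφ w
    simp only [zero_add]
    linarith

lemma amNorm_right (φ : X →ₗ[ℝ] F) (c : ℝ) (hc : 0 ≤ c)
    (hφ : ∀ x, ‖φ x‖ ≤ ‖x‖) (y : F) : amNorm φ c hc (0, y) = ‖y‖ := by
  apply le_antisymm
  · simpa using amNorm_le φ c hc (0, y) 0
  · refine le_amNorm φ c hc _ _ fun w => ?_
    have h1 := norm_sub_le (y + φ w) (φ w)
    rw [add_sub_cancel_right] at h1
    have h2 := hφ w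
    have h3 : 0 ≤ c * ‖w‖ := by positivity
    simp only [zero_sub, norm_neg]
    linarith

lemma amNorm_graph (φ : X →ₗ[ℝ] F) (c : ℝ) (hc : 0 ≤ c) (x : X) :
    amNorm φ c hc (-x, φ x) ≤ c * ‖x‖ := by
  simpa using amNorm_le φ c hc (-x, φ x) (-x)

lemma amNorm_pos (φ : X →ₗ[ℝ] F) (c : ℝ) (hc : 0 < c)
    (hφ : ∀ x, ‖φ x‖ ≤ ‖x‖) (z : X × F) (hz : amNorm φ c hc.le z = 0) : z = 0 := by
  have key : ∀ a : ℝ, 0 ≤ a → (∀ w, a ≤ (‖z.1 - w‖ + ‖z.2 + φ w‖) + ‖w‖) → a = 0 := by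
    intro a ha h
    have : min 1 c * a ≤ amNorm φ c hc.le z := by
      refine le_amNorm φ c hc.le _ _ fun w => ?_
      have h1 : min 1 c ≤ 1 := min_le_left _ _
      have h2 : min 1 c ≤ c := min_le_right _ _
      have h0 : 0 < min 1 c := lt_min one_pos hc
      have h3 := mul_le_mul_of_nonneg_left (h w) h0.le
      have h4 := mul_le_mul_of_nonneg_right h1
        (add_nonneg (norm_nonneg (z.1 - w)) (norm_nonneg (z.2 + φ w)))
      have h5 := mul_le_mul_of_nonneg_right h2 (norm_nonneg w)
      linarith
    rw [hz] at this
    have h0 : 0 < min 1 c := lt_min one_pos hc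
    by_contra hne
    have : 0 < min 1 c * a := mul_pos h0 (lt_of_le_of_ne ha (Ne.symm hne))
    linarith
  ext
  · apply norm_eq_zero.1
    refine key _ (norm_nonneg _) fun w => ?_
    have h1 := norm_sub_norm_le z.1 w
    have h2 := norm_nonneg (z.2 + φ w)
    linarith
  · apply norm_eq_zero.1
    refine key _ (norm_nonneg _) fun w => ?_
    have h1 := norm_sub_le (z.2 + φ w) (φ w)
    rw [add_sub_cancel_right] at h1
    have h2 := hφ w
    have h3 := norm_nonneg (z.1 - w)
    linarith

end Amalgam

lemma exists_model {E : Type*} [AddCommGroup E] [Module ℝ E] [FiniteDimensional ℝ E]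
    (p : Seminorm ℝ E) (hp : ∀ x, p x = 0 → x = 0) :
    ∃ (M : Type) (_ : NormedAddCommGroup M) (_ : NormedSpace ℝ M)
      (_ : FiniteDimensional ℝ M) (e : E ≃ₗ[ℝ] M), ∀ x, ‖e x‖ = p x := by
  let b := Module.finBasis ℝ E
  let e : E ≃ₗ[ℝ] (Fin (Module.finrank ℝ E) →₀ ℝ) := b.repr
  let N : AddGroupNorm (Fin (Module.finrank ℝ E) →₀ ℝ) :=
    { toFun := fun v => p (e.symm v)
      map_zero' := by simp
      add_le' := fun x y => by simpa using map_add_le_add p (e.symm x) (e.symm y)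
      neg' := fun x => by simp
      eq_zero_of_map_eq_zero' := fun x hx => by simpa using hp _ hx }
  let n1 : NormedAddCommGroup (Fin (Module.finrank ℝ E) →₀ ℝ) := N.toNormedAddCommGroup
  let n2 : NormedSpace ℝ (Fin (Module.finrank ℝ E) →₀ ℝ) :=
    { norm_smul_le := fun r x => by
        change p (e.symm (r • x)) ≤ ‖r‖ * p (e.symm x)
        rw [map_smul, map_smul_eq_mul] }
  refine ⟨_, n1, n2, ?_, e, ?_⟩
  · exact Module.Finite.of_basis (Finsupp.basisSingleOne (R := ℝ))
  · intro x
    change p (e.symm (e x)) = p x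
    simp

section Gur

variable {U V : Type*} [NormedAddCommGroup U] [NormedSpace ℝ U]
    [NormedAddCommGroup V] [NormedSpace ℝ V]

lemma gur_apply (Ω : U →L[ℝ] V) (hG : HasGurariiProperty Ω) (ε : ℝ) (hε : 0 < ε)
    {E E' X Y : Type*} [AddCommGroup E] [Module ℝ E] [FiniteDimensional ℝ E]
    [AddCommGroup E'] [Module ℝ E'] [FiniteDimensional ℝ E']
    [NormedAddCommGroup X] [NormedSpace ℝ X] [NormedAddCommGroup Y] [NormedSpace ℝ Y]
    (p : Seminorm ℝ E) (hp : ∀ x, p x = 0 → x = 0)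
    (q : Seminorm ℝ E') (hq : ∀ x, q x = 0 → x = 0)
    (T : E →ₗ[ℝ] E') (hT : ∀ x, q (T x) ≤ p x)
    (A : X →ₗ[ℝ] E) (hA : ∀ x, p (A x) = ‖x‖)
    (B : Y →ₗ[ℝ] E') (hB : ∀ x, q (B x) = ‖x‖)
    (a : X →ₗᵢ[ℝ] U) (b : Y →ₗᵢ[ℝ] V) (S : X → Y)
    (h1 : ∀ x, T (A x) = B (S x)) (h2 : ∀ x, Ω (a x) = b (S x)) :
    ∃ (i' : E →ₗ[ℝ] U) (j' : E' →ₗ[ℝ] V),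
      (∀ e, (1 + ε)⁻¹ * p e ≤ ‖i' e‖ ∧ ‖i' e‖ ≤ p e) ∧
      (∀ e, (1 + ε)⁻¹ * q e ≤ ‖j' e‖ ∧ ‖j' e‖ ≤ q e) ∧
      (∀ x, ‖i' (A x) - a x‖ ≤ ε * ‖x‖) ∧
      (∀ y, ‖j' (B y) - b y‖ ≤ ε * ‖y‖) ∧
      (∀ e, ‖Ω (i' e) - j' (T e)‖ ≤ ε * p e) := by
  obtain ⟨M, _, _, _, e, he⟩ := exists_model p hp
  obtain ⟨M', _, _, _, e', he'⟩ := exists_model q hq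
  let A' : X →ₗᵢ[ℝ] M := ⟨e.toLinearMap.comp A, fun x => by simp [he, hA]⟩
  let B' : Y →ₗᵢ[ℝ] M' := ⟨e'.toLinearMap.comp B, fun x => by simp [he', hB]⟩
  let T₀ : M →ₗ[ℝ] M' := e'.toLinearMap.comp (T.comp e.symm.toLinearMap)
  have hT₀ : ∀ m, ‖T₀ m‖ ≤ 1 * ‖m‖ := by
    intro m
    obtain ⟨x, rfl⟩ := e.surjective m
    simpa [T₀, he, he'] using hT x
  let T' : M →L[ℝ] M' := T₀.mkContinuous 1 hT₀
  have hT' : ∀ x, T' (e x) = e' (T x) := by intro x; simp [T', T₀]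
  have hTA : ∀ x, T' (A' x) = B' (S x) := by
    intro x
    change T' (e (A x)) = e' (B (S x))
    rw [hT', h1]
  have hmem : ∀ x ∈ LinearMap.range A'.toLinearMap, T' x ∈ LinearMap.range B'.toLinearMap := by
    rintro _ ⟨x, rfl⟩
    exact ⟨S x, (hTA x).symm⟩
  let eA := A'.equivRange
  let eB := B'.equivRange
  obtain ⟨i', j', hi, hj, hi2, hj2, hc⟩ := hG ε hε M M' (LinearMap.range A'.toLinearMap)
    (LinearMap.range B'.toLinearMap) T' (T₀.mkContinuous_norm_le zero_le_one hT₀) hmem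
    (a.comp eA.symm.toLinearIsometry) (b.comp eB.symm.toLinearIsometry) (by
      intro x
      obtain ⟨x, rfl⟩ := eA.surjective x
      have : (⟨T' (eA x), hmem _ (eA x).2⟩ : LinearMap.range B'.toLinearMap) = eB (S x) :=
        Subtype.ext (hTA x)
      rw [this]
      simp [h2])
  refine ⟨i'.toLinearMap.comp e.toLinearMap, j'.toLinearMap.comp e'.toLinearMap, ?_, ?_, ?_, ?_, ?_⟩
  · intro x; simpa [he] using hi (e x)
  · intro x; simpa [he'] using hj (e' x)
  · intro x
    have h := ContinuousLinearMap.le_of_opNorm_le _ hi2.le (eA x)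
    have h3 : ((eA x : LinearMap.range A'.toLinearMap) : M) = e (A x) := rfl
    simpa [h3] using h
  · intro x
    have h := ContinuousLinearMap.le_of_opNorm_le _ hj2.le (eB x)
    have h3 : ((eB x : LinearMap.range B'.toLinearMap) : M') = e' (B x) := rfl
    simpa [h3] using h
  · intro x
    have h := ContinuousLinearMap.le_of_opNorm_le _ hc.le (e x)
    simpa [hT', he] using h

lemma gur_step (Ω : U →L[ℝ] V) (hΩ : ‖Ω‖ ≤ 1) (hG : HasGurariiProperty Ω)
    (δ η : ℝ) (hη : 0 < η) (hηδ : η ≤ δ)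
    (X F : Submodule ℝ U) (Y G : Submodule ℝ V)
    [FiniteDimensional ℝ X] [FiniteDimensional ℝ F]
    [FiniteDimensional ℝ Y] [FiniteDimensional ℝ G]
    (f : U →ₗ[ℝ] U) (g : V →ₗ[ℝ] V)
    (hXF : ∀ x ∈ X, f x ∈ F) (hYG : ∀ x ∈ Y, g x ∈ G)
    (hXY : ∀ x ∈ X, Ω x ∈ Y) (hFG : ∀ x ∈ F, Ω x ∈ G)
    (hf : ∀ x ∈ X, (1 + δ)⁻¹ * ‖x‖ ≤ ‖f x‖ ∧ ‖f x‖ ≤ ‖x‖)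
    (hg : ∀ x ∈ Y, (1 + δ)⁻¹ * ‖x‖ ≤ ‖g x‖ ∧ ‖g x‖ ≤ ‖x‖)
    (hc : ∀ x ∈ X, ‖Ω (f x) - g (Ω x)‖ ≤ δ * ‖x‖) :
    ∃ (f' : U →ₗ[ℝ] U) (g' : V →ₗ[ℝ] V),
      (∀ x ∈ F, (1 + η)⁻¹ * ‖x‖ ≤ ‖f' x‖ ∧ ‖f' x‖ ≤ ‖x‖) ∧
      (∀ x ∈ G, (1 + η)⁻¹ * ‖x‖ ≤ ‖g' x‖ ∧ ‖g' x‖ ≤ ‖x‖) ∧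
      (∀ x ∈ F, ‖Ω (f' x) - g' (Ω x)‖ ≤ η * ‖x‖) ∧
      (∀ x ∈ X, ‖f' (f x) - x‖ ≤ 3 * δ * ‖x‖) ∧
      (∀ x ∈ Y, ‖g' (g x) - x‖ ≤ 3 * δ * ‖x‖) := by
  have hδ : 0 < δ := hη.trans_le hηδ
  have hinv : 1 - δ ≤ (1 + δ)⁻¹ := by
    rw [← one_div, le_div_iff₀ (by linarith)]
    nlinarith
  have hΩ' : ∀ x, ‖Ω x‖ ≤ ‖x‖ := fun x => by simpa using Ω.le_of_opNorm_le hΩ x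
  let φ : X →ₗ[ℝ] F := f.restrict hXF
  let γ : Y →ₗ[ℝ] G := g.restrict hYG
  let ΩX : X →ₗ[ℝ] Y := Ω.toLinearMap.restrict hXY
  let ΩF : F →ₗ[ℝ] G := Ω.toLinearMap.restrict hFG
  have hφ1 : ∀ x, ‖φ x‖ ≤ ‖x‖ := fun x => (hf x x.2).2
  have hγ1 : ∀ x, ‖γ x‖ ≤ ‖x‖ := fun x => (hg x x.2).2
  have hφ2 : ∀ x, (1 + δ)⁻¹ * ‖x‖ ≤ ‖φ x‖ := fun x => (hf x x.2).1
  have hγ2 : ∀ x, (1 + δ)⁻¹ * ‖x‖ ≤ ‖γ x‖ := fun x => (hg x x.2).1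
  have hφ3 : ∀ x, (1 - 2 * δ) * ‖x‖ ≤ ‖φ x‖ := fun x =>
    (mul_le_mul_of_nonneg_right (by linarith) (norm_nonneg x)).trans (hφ2 x)
  have hγ3 : ∀ x, (1 - δ) * ‖x‖ ≤ ‖γ x‖ := fun x =>
    (mul_le_mul_of_nonneg_right (by linarith) (norm_nonneg x)).trans (hγ2 x)
  have h2δ : 0 < 2 * δ := by linarith
  have hT : ∀ z : X × F, amNorm γ δ hδ.le (ΩX.prodMap ΩF z) ≤ amNorm φ (2 * δ) h2δ.le z := by
    intro z
    refine le_amNorm _ _ _ _ _ fun w => ?_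
    refine (amNorm_le _ _ _ _ (ΩX w)).trans ?_
    have e1 : (ΩX.prodMap ΩF z).1 - ΩX w = ΩX (z.1 - w) := by simp
    have e2 : (ΩX.prodMap ΩF z).2 + γ (ΩX w) = ΩF (z.2 + φ w) - (ΩF (φ w) - γ (ΩX w)) := by
      simp only [LinearMap.prodMap_apply, map_add]
      abel
    rw [e1, e2]
    have n1 : ‖ΩX (z.1 - w)‖ ≤ ‖z.1 - w‖ := hΩ' _
    have n2 : ‖ΩF (z.2 + φ w)‖ ≤ ‖z.2 + φ w‖ := hΩ' _
    have n3 : ‖ΩF (φ w) - γ (ΩX w)‖ ≤ δ * ‖w‖ := hc w w.2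
    have n4 : ‖ΩX w‖ ≤ ‖w‖ := hΩ' _
    have n5 := norm_sub_le (ΩF (z.2 + φ w)) (ΩF (φ w) - γ (ΩX w))
    have n6 := mul_le_mul_of_nonneg_left n4 hδ.le
    linarith
  obtain ⟨i', j', hi, hj, hi2, hj2, hcc⟩ := gur_apply Ω hG η hη
    (amNorm φ (2 * δ) h2δ.le) (amNorm_pos φ _ h2δ hφ1)
    (amNorm γ δ hδ.le) (amNorm_pos γ _ hδ hγ1)
    (ΩX.prodMap ΩF) hT
    (LinearMap.inl ℝ X F) (amNorm_left φ _ h2δ.le hφ3)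
    (LinearMap.inl ℝ Y G) (amNorm_left γ _ hδ.le hγ3)
    X.subtypeₗᵢ Y.subtypeₗᵢ ΩX (by intro x; simp) (by intro x; rfl)
  obtain ⟨f', hf'⟩ := LinearMap.exists_extend (i'.comp (LinearMap.inr ℝ X F))
  obtain ⟨g', hg'⟩ := LinearMap.exists_extend (j'.comp (LinearMap.inr ℝ Y G))
  have hf'' : ∀ x : F, f' x = i' (0, x) := fun x => LinearMap.congr_fun hf' x
  have hg'' : ∀ x : G, g' x = j' (0, x) := fun x => LinearMap.congr_fun hg' x
  refine ⟨f', g', ?_, ?_, ?_, ?_, ?_⟩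
  · intro x hx
    have := hi (0, ⟨x, hx⟩)
    rw [amNorm_right φ _ h2δ.le hφ1, ← hf''] at this
    exact this
  · intro x hx
    have := hj (0, ⟨x, hx⟩)
    rw [amNorm_right γ _ hδ.le hγ1, ← hg''] at this
    exact this
  · intro x hx
    have := hcc (0, ⟨x, hx⟩)
    rw [amNorm_right φ _ h2δ.le hφ1, ← hf''] at this
    have e : (ΩX.prodMap ΩF) (0, ⟨x, hx⟩) = (0, ΩF ⟨x, hx⟩) := by simp
    rw [e, ← hg''] at this
    exact this
  · intro x hx
    have h1 : ‖i' (-⟨x, hx⟩, φ ⟨x, hx⟩)‖ ≤ 2 * δ * ‖x‖ :=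
      (hi _).2.trans (amNorm_graph φ _ h2δ.le ⟨x, hx⟩)
    have h2 : ‖i' (⟨x, hx⟩, 0) - x‖ ≤ η * ‖x‖ := hi2 ⟨x, hx⟩
    have h3 : f' (f x) - x = i' (-⟨x, hx⟩, φ ⟨x, hx⟩) + (i' (⟨x, hx⟩, 0) - x) := by
      have : f' (f x) = i' (0, φ ⟨x, hx⟩) := hf'' (φ ⟨x, hx⟩)
      rw [this, ← add_sub_assoc, ← map_add]
      simp
    rw [h3]
    have := norm_add_le (i' (-⟨x, hx⟩, φ ⟨x, hx⟩)) (i' (⟨x, hx⟩, 0) - x)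
    have := mul_le_mul_of_nonneg_right hηδ (norm_nonneg x)
    linarith
  · intro x hx
    have h1 : ‖j' (-⟨x, hx⟩, γ ⟨x, hx⟩)‖ ≤ δ * ‖x‖ :=
      (hj _).2.trans (amNorm_graph γ _ hδ.le ⟨x, hx⟩)
    have h2 : ‖j' (⟨x, hx⟩, 0) - x‖ ≤ η * ‖x‖ := hj2 ⟨x, hx⟩
    have h3 : g' (g x) - x = j' (-⟨x, hx⟩, γ ⟨x, hx⟩) + (j' (⟨x, hx⟩, 0) - x) := by
      have : g' (g x) = j' (0, γ ⟨x, hx⟩) := hg'' (γ ⟨x, hx⟩)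
      rw [this, ← add_sub_assoc, ← map_add]
      simp
    rw [h3]
    have := norm_add_le (j' (-⟨x, hx⟩, γ ⟨x, hx⟩)) (j' (⟨x, hx⟩, 0) - x)
    have := mul_le_mul_of_nonneg_right hηδ (norm_nonneg x)
    have : 0 ≤ δ * ‖x‖ := by positivity
    linarith

end Gur

section Limit

lemma lim_lemma {U : Type*} [NormedAddCommGroup U] [NormedSpace ℝ U] [CompleteSpace U]
    (F : ℕ → Submodule ℝ U) (f : ℕ → U →ₗ[ℝ] U) (d : ℝ) (hd : 0 < d)
    (hmono : Monotone F) (hdense : Dense (⋃ n, (F n : Set U)))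
    (hmap : ∀ n, ∀ x ∈ F n, f n x ∈ F (n + 1))
    (hf : ∀ n, ∀ x ∈ F n, (1 + d * (1 / 2) ^ n)⁻¹ * ‖x‖ ≤ ‖f n x‖ ∧ ‖f n x‖ ≤ ‖x‖)
    (hff : ∀ n, ∀ x ∈ F n, ‖f (n + 1) (f n x) - x‖ ≤ 3 * (d * (1 / 2) ^ n) * ‖x‖) :
    ∃ I : U →ₗᵢ[ℝ] U, Function.Surjective I ∧
      (∀ n, ∀ x ∈ F n, Tendsto (fun k => f (2 * k) x) atTop (𝓝 (I x))) ∧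
      (∀ k, ∀ x ∈ F (2 * k), ‖f (2 * k) x - I x‖ ≤ 8 * (d * (1 / 2) ^ (2 * k)) * ‖x‖) := by
  have hstep : ∀ n, ∀ x ∈ F n, ‖f n x - f (n + 2) x‖ ≤ 6 * (d * (1 / 2) ^ n) * ‖x‖ := by
    intro n x hx
    have hx1 := hmap n x hx
    have hx2 := hmono (Nat.le_add_right n 2) hx
    have hx3 : f (n + 1) (f n x) - x ∈ F (n + 2) := sub_mem (hmap _ _ hx1) hx2
    have h1 := (hf _ _ hx3).2.trans (hff n x hx)
    have h2 := hff _ _ hx1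
    have h3 := mul_le_mul_of_nonneg_left (hf n x hx).2
      (show 0 ≤ 3 * (d * (1 / 2) ^ (n + 1)) by positivity)
    have h4 : (0 : ℝ) ≤ 3 * (d * (1 / 2) ^ (n + 1)) * ‖x‖ := by positivity
    have h5 : 3 * (d * (1 / 2) ^ n) * ‖x‖ = 2 * (3 * (d * (1 / 2) ^ (n + 1)) * ‖x‖) := by
      rw [pow_succ]; ring
    have e : f n x - f (n + 2) x = f (n + 2) (f (n + 1) (f n x) - x)
        - (f (n + 1 + 1) (f (n + 1) (f n x)) - f n x) := by
      rw [map_sub]; abel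
    have h6 := norm_sub_le (f (n + 2) (f (n + 1) (f n x) - x))
      (f (n + 1 + 1) (f (n + 1) (f n x)) - f n x)
    rw [e]
    linarith
  have hgeo : ∀ k, ∀ x ∈ F (2 * k), ∀ m,
      dist (f (2 * (m + k)) x) (f (2 * ((m + 1) + k)) x)
        ≤ (6 * (d * (1 / 2) ^ (2 * k)) * ‖x‖) * (1 / 4) ^ m := by
    intro k x hx m
    have h := hstep (2 * (m + k)) x (hmono (by omega) hx)
    rw [dist_eq_norm]
    have e1 : 2 * (m + 1 + k) = 2 * (m + k) + 2 := by ring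
    rw [e1]
    refine h.trans (le_of_eq ?_)
    have e2 : (1 / 2 : ℝ) ^ (2 * (m + k)) = (1 / 2) ^ (2 * k) * (1 / 4) ^ m := by
      rw [mul_add, pow_add, pow_mul (1 / 2 : ℝ) 2 m, mul_comm]; norm_num
    rw [e2]; ring
  have hconv : ∀ n, ∀ x ∈ F n, ∃ l, Tendsto (fun k => f (2 * k) x) atTop (𝓝 l) := by
    intro n x hx
    have hx' : x ∈ F (2 * n) := hmono (by omega) hx
    have hC := cauchySeq_of_le_geometric _ _ (by norm_num : (1 / 4 : ℝ) < 1) (hgeo n x hx')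
    obtain ⟨l, hl⟩ := cauchySeq_tendsto_of_complete hC
    exact ⟨l, (tendsto_add_atTop_iff_nat (f := fun k => f (2 * k) x) n).1 hl⟩
  have hlim : ∀ k, ∀ x ∈ F (2 * k), ∀ l, Tendsto (fun k => f (2 * k) x) atTop (𝓝 l) →
      ‖f (2 * k) x - l‖ ≤ 8 * (d * (1 / 2) ^ (2 * k)) * ‖x‖ := by
    intro k x hx l hl
    have h := dist_le_of_le_geometric_of_tendsto₀ _ _ (by norm_num : (1 / 4 : ℝ) < 1) (hgeo k x hx)
      ((tendsto_add_atTop_iff_nat (f := fun k => f (2 * k) x) k).2 hl)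
    rw [dist_eq_norm, zero_add] at h
    refine h.trans (le_of_eq ?_)
    ring
  have hdlim : Tendsto (fun n : ℕ => d * (1 / 2 : ℝ) ^ n) atTop (𝓝 0) := by
    simpa using (tendsto_pow_atTop_nhds_zero_of_lt_one (by norm_num : (0 : ℝ) ≤ 1 / 2)
      (by norm_num)).const_mul d
  have h2k : Tendsto (fun k : ℕ => 2 * k) atTop atTop :=
    tendsto_atTop_mono (fun k => by simp only [id]; omega) tendsto_id
  have hnorm : ∀ n, ∀ x ∈ F n, ∀ l, Tendsto (fun k => f (2 * k) x) atTop (𝓝 l) → ‖l‖ = ‖x‖ := by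
    intro n x hx l hl
    have hmem : ∀ᶠ k in atTop, x ∈ F (2 * k) :=
      (eventually_ge_atTop n).mono fun k hk => hmono (by omega) hx
    have t1 : Tendsto (fun k : ℕ => (1 + d * (1 / 2 : ℝ) ^ (2 * k))⁻¹ * ‖x‖) atTop (𝓝 ‖x‖) := by
      have := (((hdlim.comp h2k).const_add 1).inv₀ (by norm_num)).mul_const ‖x‖
      simpa using this
    refine tendsto_nhds_unique hl.norm ?_
    exact tendsto_of_tendsto_of_tendsto_of_le_of_le' t1 tendsto_const_nhds
      (hmem.mono fun k hk => (hf _ _ hk).1) (hmem.mono fun k hk => (hf _ _ hk).2)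
  let D : Submodule ℝ U := ⨆ n, F n
  have hD : ∀ x, x ∈ D ↔ ∃ n, x ∈ F n := fun x =>
    Submodule.mem_iSup_of_directed F hmono.directed_le
  have hDdense : DenseRange D.subtype := by
    have : Set.range D.subtype = ⋃ n, (F n : Set U) := by
      ext x
      simp [hD]
    rw [DenseRange, this]
    exact hdense
  have hconvD : ∀ x : D, ∃ l, Tendsto (fun k => f (2 * k) x) atTop (𝓝 l) := fun x => by
    obtain ⟨n, hn⟩ := (hD x).1 x.2
    exact hconv n x hn
  choose A hA using hconvD
  let L : D →ₗ[ℝ] U := linearMapOfTendsto A (fun k => (f (2 * k)).comp D.subtype)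
    (l := atTop) (tendsto_pi_nhds.2 hA)
  have hL : ∀ x, L x = A x := fun x => rfl
  have hLn : ∀ x, ‖L x‖ = ‖D.subtype x‖ := fun x => by
    obtain ⟨n, hn⟩ := (hD x).1 x.2
    exact hnorm n x hn _ (hA x)
  have hb : ∃ C, ∀ x, ‖L x‖ ≤ C * ‖D.subtype x‖ := ⟨1, fun x => by rw [hLn, one_mul]⟩
  let I₀ : U →L[ℝ] U := L.extendOfNorm D.subtype
  have hI₀ : ∀ x : D, I₀ x = A x := fun x => LinearMap.extendOfNorm_eq hDdense hb x
  have hI₀n : ∀ x, ‖I₀ x‖ = ‖x‖ := by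
    intro x
    refine hDdense.induction_on (p := fun x => ‖I₀ x‖ = ‖x‖) x ?_ ?_
    · exact isClosed_eq (by fun_prop) (by fun_prop)
    · intro a
      change ‖I₀ a‖ = _
      rw [hI₀]; exact hLn a
  let I : U →ₗᵢ[ℝ] U := ⟨I₀.toLinearMap, hI₀n⟩
  have hI : ∀ n, ∀ x ∈ F n, Tendsto (fun k => f (2 * k) x) atTop (𝓝 (I x)) := by
    intro n x hx
    have : I x = A ⟨x, (hD x).2 ⟨n, hx⟩⟩ := hI₀ ⟨x, (hD x).2 ⟨n, hx⟩⟩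
    rw [this]
    exact hA ⟨x, (hD x).2 ⟨n, hx⟩⟩
  have hI2 : ∀ k, ∀ x ∈ F (2 * k),
      ‖f (2 * k) x - I x‖ ≤ 8 * (d * (1 / 2) ^ (2 * k)) * ‖x‖ :=
    fun k x hx => hlim k x hx _ (hI _ x hx)
  refine ⟨I, ?_, hI, hI2⟩
  have hcl : IsClosed (Set.range I) := I.isometry.isClosedEmbedding.isClosed_range
  have hsub : (⋃ n, (F n : Set U)) ⊆ Set.range I := by
    intro x hx
    obtain ⟨n, hn⟩ := Set.mem_iUnion.1 hx
    refine hcl.mem_of_tendsto (f := fun k : ℕ => I (f (2 * k + 1) x)) (b := atTop) ?_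
      (Eventually.of_forall fun k => ⟨_, rfl⟩)
    rw [tendsto_iff_norm_sub_tendsto_zero]
    have t1 : Tendsto (fun k : ℕ => 11 * (d * (1 / 2 : ℝ) ^ (2 * k)) * ‖x‖) atTop (𝓝 0) := by
      simpa using ((hdlim.comp h2k).const_mul 11).mul_const ‖x‖
    refine squeeze_zero' (Eventually.of_forall fun k => norm_nonneg _) ?_ t1
    filter_upwards [eventually_ge_atTop n] with k hk
    have hxk : x ∈ F (2 * k + 1) := hmono (by omega) hn
    have h1 := hI2 (k + 1) (f (2 * k + 1) x) (hmap _ _ hxk)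
    have h2 : ‖f (2 * (k + 1)) (f (2 * k + 1) x) - x‖ ≤
        3 * (d * (1 / 2) ^ (2 * k + 1)) * ‖x‖ := hff (2 * k + 1) x hxk
    have h3 := (hf _ x hxk).2
    have h4 := norm_sub_le (f (2 * (k + 1)) (f (2 * k + 1) x) - x)
      (f (2 * (k + 1)) (f (2 * k + 1) x) - I (f (2 * k + 1) x))
    have e : (f (2 * (k + 1)) (f (2 * k + 1) x) - x) -
      (f (2 * (k + 1)) (f (2 * k + 1) x) - I (f (2 * k + 1) x)) = I (f (2 * k + 1) x) - x := by
      abel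
    rw [e] at h4
    have h5 : (1 / 2 : ℝ) ^ (2 * (k + 1)) = (1 / 4) * (1 / 2) ^ (2 * k) := by
      rw [mul_add, pow_add]; ring
    have h6 : (1 / 2 : ℝ) ^ (2 * k + 1) = (1 / 2) * (1 / 2) ^ (2 * k) := by
      rw [pow_succ]; ring
    rw [h5] at h1
    rw [h6] at h2
    have h7 : (0 : ℝ) ≤ d * (1 / 2) ^ (2 * k) := by positivity
    have h8 := mul_le_mul_of_nonneg_left h3 h7
    have h9 : 0 ≤ (d * (1 / 2) ^ (2 * k)) * ‖x‖ := by positivity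
    nlinarith
  intro x
  have : closure (⋃ n, (F n : Set U)) ⊆ Set.range I := closure_minimal hsub hcl
  exact this (hdense x)

end Limit

section BackForth

variable {U V : Type*} [NormedAddCommGroup U] [NormedSpace ℝ U]
    [NormedAddCommGroup V] [NormedSpace ℝ V]

/-- A stage of the back-and-forth construction. -/
structure BFStage (Ω : U →L[ℝ] V) (δ : ℝ) where
  X : Submodule ℝ U
  Y : Submodule ℝ V
  f : U →ₗ[ℝ] U
  g : V →ₗ[ℝ] V
  fdX : FiniteDimensional ℝ X
  fdY : FiniteDimensional ℝ Y
  hXY : ∀ x ∈ X, Ω x ∈ Y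
  hf : ∀ x ∈ X, (1 + δ)⁻¹ * ‖x‖ ≤ ‖f x‖ ∧ ‖f x‖ ≤ ‖x‖
  hg : ∀ x ∈ Y, (1 + δ)⁻¹ * ‖x‖ ≤ ‖g x‖ ∧ ‖g x‖ ≤ ‖x‖
  hc : ∀ x ∈ X, ‖Ω (f x) - g (Ω x)‖ ≤ δ * ‖x‖

lemma bf_step (Ω : U →L[ℝ] V) (hΩ : ‖Ω‖ ≤ 1) (hG : HasGurariiProperty Ω)
    (δ η : ℝ) (hη : 0 < η) (hηδ : η ≤ δ) (u : U) (v : V) (s : BFStage Ω δ) :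
    ∃ t : BFStage Ω η, s.X ≤ t.X ∧ s.Y ≤ t.Y ∧ u ∈ t.X ∧ v ∈ t.Y ∧
      (∀ x ∈ s.X, s.f x ∈ t.X) ∧ (∀ y ∈ s.Y, s.g y ∈ t.Y) ∧
      (∀ x ∈ s.X, ‖t.f (s.f x) - x‖ ≤ 3 * δ * ‖x‖) ∧
      (∀ x ∈ s.Y, ‖t.g (s.g x) - x‖ ≤ 3 * δ * ‖x‖) := by
  have := s.fdX
  have := s.fdY
  let F : Submodule ℝ U := (s.X ⊔ s.X.map s.f) ⊔ Submodule.span ℝ {u}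
  let G : Submodule ℝ V := ((s.Y ⊔ s.Y.map s.g) ⊔ Submodule.span ℝ {v}) ⊔ F.map Ω.toLinearMap
  have hF : FiniteDimensional ℝ F := by
    dsimp only [F]; infer_instance
  have hGd : FiniteDimensional ℝ G := by
    dsimp only [G]; infer_instance
  have hFG : ∀ x ∈ F, Ω x ∈ G := fun x hx =>
    Submodule.mem_sup_right (Submodule.mem_map_of_mem (f := Ω.toLinearMap) hx)
  have hXF : ∀ x ∈ s.X, s.f x ∈ F := fun x hx =>
    Submodule.mem_sup_left (Submodule.mem_sup_right (Submodule.mem_map_of_mem hx))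
  have hYG : ∀ x ∈ s.Y, s.g x ∈ G := fun x hx =>
    Submodule.mem_sup_left (Submodule.mem_sup_left
      (Submodule.mem_sup_right (Submodule.mem_map_of_mem hx)))
  obtain ⟨f', g', h1, h2, h3, h4, h5⟩ := gur_step Ω hΩ hG δ η hη hηδ s.X F s.Y G s.f s.g
    hXF hYG s.hXY hFG s.hf s.hg s.hc
  refine ⟨⟨F, G, f', g', hF, hGd, hFG, h1, h2, h3⟩, ?_, ?_, ?_, ?_, hXF, hYG, h4, h5⟩
  · exact fun x hx => Submodule.mem_sup_left (Submodule.mem_sup_left hx)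
  · exact fun x hx => Submodule.mem_sup_left (Submodule.mem_sup_left (Submodule.mem_sup_left hx))
  · exact Submodule.mem_sup_right (Submodule.mem_span_singleton_self u)
  · exact Submodule.mem_sup_left (Submodule.mem_sup_right (Submodule.mem_span_singleton_self v))

lemma dense_of_denseSeq {W : Type*} [NormedAddCommGroup W] [NormedSpace ℝ W]
    [TopologicalSpace.SeparableSpace W] (F : ℕ → Submodule ℝ W)
    (h : ∀ n, TopologicalSpace.denseSeq W n ∈ F (n + 1)) : Dense (⋃ n, (F n : Set W)) := by
  refine (TopologicalSpace.denseRange_denseSeq W).mono ?_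
  rintro _ ⟨n, rfl⟩
  exact Set.mem_iUnion.2 ⟨n + 1, h n⟩

end BackForth

/-- Almost homogeneity of an operator with the Gurarii property. -/
theorem almost_homogeneous_of_GurariiProperty
    {U V : Type*}
    [NormedAddCommGroup U] [NormedSpace ℝ U] [CompleteSpace U]
    [TopologicalSpace.SeparableSpace U]
    [NormedAddCommGroup V] [NormedSpace ℝ V] [CompleteSpace V]
    [TopologicalSpace.SeparableSpace V]
    (Ω : U →L[ℝ] V) (hΩ : ‖Ω‖ ≤ 1) (hG : HasGurariiProperty Ω)
    (ε : ℝ) (hε : 0 < ε)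
    (X₀ X₁ : Submodule ℝ U) (Y₀ Y₁ : Submodule ℝ V)
    [FiniteDimensional ℝ X₀] [FiniteDimensional ℝ X₁]
    [FiniteDimensional ℝ Y₀] [FiniteDimensional ℝ Y₁]
    (hX₀ : ∀ x ∈ X₀, Ω x ∈ Y₀) (hX₁ : ∀ x ∈ X₁, Ω x ∈ Y₁)
    (i : X₀ →ₗᵢ[ℝ] X₁) (j : Y₀ →ₗᵢ[ℝ] Y₁)
    (hij : ∀ x : X₀, Ω ((i x : U)) = (j ⟨Ω x, hX₀ x x.2⟩ : V)) :
    ∃ (I : U →ₗᵢ[ℝ] U) (J : V →ₗᵢ[ℝ] V),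
      Function.Surjective I ∧ Function.Surjective J ∧
      (∀ x : U, Ω (I x) = J (Ω x)) ∧
      ‖I.toContinuousLinearMap.comp X₀.subtypeL -
        X₁.subtypeL.comp i.toContinuousLinearMap‖ ≤ ε ∧
      ‖J.toContinuousLinearMap.comp Y₀.subtypeL -
        Y₁.subtypeL.comp j.toContinuousLinearMap‖ ≤ ε := by
  let d : ℝ := ε / 8
  have hd : 0 < d := by positivity
  have hdn : ∀ n : ℕ, 0 < d * (1 / 2 : ℝ) ^ n := fun n => by positivity
  have hdle : ∀ n : ℕ, d * (1 / 2 : ℝ) ^ (n + 1) ≤ d * (1 / 2 : ℝ) ^ n := fun n => by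
    have := hdn n
    rw [pow_succ]
    linarith
  obtain ⟨f₀, hf₀⟩ := LinearMap.exists_extend (X₁.subtype.comp i.toLinearMap)
  obtain ⟨g₀, hg₀⟩ := LinearMap.exists_extend (Y₁.subtype.comp j.toLinearMap)
  have hf₀' : ∀ x : X₀, f₀ x = (i x : U) := fun x => LinearMap.congr_fun hf₀ x
  have hg₀' : ∀ x : Y₀, g₀ x = (j x : V) := fun x => LinearMap.congr_fun hg₀ x
  have hfn : ∀ x ∈ X₀, ‖f₀ x‖ = ‖x‖ := fun x hx => by
    rw [hf₀' ⟨x, hx⟩]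
    exact i.norm_map ⟨x, hx⟩
  have hgn : ∀ x ∈ Y₀, ‖g₀ x‖ = ‖x‖ := fun x hx => by
    rw [hg₀' ⟨x, hx⟩]
    exact j.norm_map ⟨x, hx⟩
  have hinv : (1 + d * (1 / 2 : ℝ) ^ 0)⁻¹ ≤ 1 := inv_le_one_of_one_le₀ (by linarith [hdn 0])
  let s₀ : BFStage Ω (d * (1 / 2 : ℝ) ^ 0) :=
    { X := X₀, Y := Y₀, f := f₀, g := g₀, fdX := inferInstance, fdY := inferInstance
      hXY := hX₀
      hf := fun x hx => by
        rw [hfn x hx]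
        exact ⟨mul_le_of_le_one_left (norm_nonneg x) hinv, le_rfl⟩
      hg := fun x hx => by
        rw [hgn x hx]
        exact ⟨mul_le_of_le_one_left (norm_nonneg x) hinv, le_rfl⟩
      hc := fun x hx => by
        have h1 : Ω (f₀ x) = g₀ (Ω x) := by
          rw [hf₀' ⟨x, hx⟩, hij ⟨x, hx⟩]
          exact (hg₀' ⟨Ω x, hX₀ x hx⟩).symm
        rw [h1, sub_self, norm_zero]
        exact mul_nonneg (hdn 0).le (norm_nonneg x) }
  choose next hnext using fun (n : ℕ) (s : BFStage Ω (d * (1 / 2 : ℝ) ^ n)) =>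
    bf_step Ω hΩ hG _ _ (hdn (n + 1)) (hdle n) (TopologicalSpace.denseSeq U n)
      (TopologicalSpace.denseSeq V n) s
  let S : (n : ℕ) → BFStage Ω (d * (1 / 2 : ℝ) ^ n) := fun n => Nat.rec s₀ next n
  have hS : ∀ n, S (n + 1) = next n (S n) := fun n => rfl
  have hstep := fun n => hnext n (S n)
  simp only [← hS] at hstep
  obtain ⟨I, hI1, hI2, hI3⟩ := lim_lemma (fun n => (S n).X) (fun n => (S n).f) d hd
    (monotone_nat_of_le_succ fun n => (hstep n).1)
    (dense_of_denseSeq _ fun n => (hstep n).2.2.1)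
    (fun n => (hstep n).2.2.2.2.1) (fun n => (S n).hf) (fun n => (hstep n).2.2.2.2.2.2.1)
  obtain ⟨J, hJ1, hJ2, hJ3⟩ := lim_lemma (fun n => (S n).Y) (fun n => (S n).g) d hd
    (monotone_nat_of_le_succ fun n => (hstep n).2.1)
    (dense_of_denseSeq _ fun n => (hstep n).2.2.2.1)
    (fun n => (hstep n).2.2.2.2.2.1) (fun n => (S n).hg) (fun n => (hstep n).2.2.2.2.2.2.2)
  have hmonoX : Monotone fun n => (S n).X := monotone_nat_of_le_succ fun n => (hstep n).1
  have hdense : Dense (⋃ n, ((S n).X : Set U)) := dense_of_denseSeq _ fun n => (hstep n).2.2.1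
  refine ⟨I, J, hI1, hJ1, ?_, ?_, ?_⟩
  · have hEq : Set.EqOn (fun x => Ω (I x)) (fun x => J (Ω x)) (⋃ n, ((S n).X : Set U)) := by
      intro x hx
      obtain ⟨n, hn⟩ := Set.mem_iUnion.1 hx
      have t1 := (Ω.continuous.tendsto _).comp (hI2 n x hn)
      have t2 := hJ2 n (Ω x) ((S n).hXY x hn)
      have t3 := t1.sub t2
      have hdlim : Tendsto (fun k : ℕ => d * (1 / 2 : ℝ) ^ (2 * k) * ‖x‖) atTop (𝓝 0) := by
        have h2k : Tendsto (fun k : ℕ => 2 * k) atTop atTop :=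
          tendsto_atTop_mono (fun k => by simp only [id]; omega) tendsto_id
        have := (((tendsto_pow_atTop_nhds_zero_of_lt_one (by norm_num : (0 : ℝ) ≤ 1 / 2)
          (by norm_num)).comp h2k).const_mul d).mul_const ‖x‖
        simpa using this
      have t4 : Tendsto (fun k : ℕ => Ω ((S (2 * k)).f x) - (S (2 * k)).g (Ω x)) atTop (𝓝 0) := by
        rw [tendsto_zero_iff_norm_tendsto_zero]
        refine squeeze_zero' (Eventually.of_forall fun k => norm_nonneg _) ?_ hdlim
        filter_upwards [eventually_ge_atTop n] with k hk
        exact (S (2 * k)).hc x (hmonoX (by omega : n ≤ 2 * k) hn)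
      exact sub_eq_zero.1 (tendsto_nhds_unique t3 t4)
    have := Continuous.ext_on hdense (Ω.continuous.comp I.continuous)
      (J.continuous.comp Ω.continuous) hEq
    exact fun x => congrFun this x
  · refine ContinuousLinearMap.opNorm_le_bound _ hε.le fun x => ?_
    have h := hI3 0 (x : U) x.2
    have e : (S (2 * 0)).f (x : U) = (i x : U) := hf₀' x
    rw [e, norm_sub_rev] at h
    refine h.trans (le_of_eq ?_)
    simp only [mul_zero, pow_zero, mul_one, d, Submodule.coe_norm]
    ring
  · refine ContinuousLinearMap.opNorm_le_bound _ hε.le fun x => ?_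
    have h := hJ3 0 (x : V) x.2
    have e : (S (2 * 0)).g (x : V) = (j x : V) := hg₀' x
    rw [e, norm_sub_rev] at h
    refine h.trans (le_of_eq ?_)
    simp only [mul_zero, pow_zero, mul_one, d, Submodule.coe_norm]
    ring
end

section
/- Every nonexpansive linear operator Ω: U→V between separable Banach spaces satisfying condition (G) also satisfies condition (G*); that is, conditions (G) and (G*) are equivalent for nonexpansive operators between separable Banach spaces. -/
/-- Type synonym carrying the amalgamated norm. -/
def AmalgSpace (X E : Type) : Type := X × E

instance (X E : Type) [AddCommGroup X] [AddCommGroup E] : AddCommGroup (AmalgSpace X E) :=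
  inferInstanceAs (AddCommGroup (X × E))

instance (X E : Type) [AddCommGroup X] [AddCommGroup E] [Module ℝ X] [Module ℝ E] :
    Module ℝ (AmalgSpace X E) :=
  inferInstanceAs (Module ℝ (X × E))

/-- The canonical equivalence. -/
def amalgEquiv (X E : Type) [AddCommGroup X] [AddCommGroup E] [Module ℝ X] [Module ℝ E] :
    (X × E) ≃ₗ[ℝ] AmalgSpace X E := LinearEquiv.refl ℝ (X × E)

theorem amalg_exists {U : Type*} [NormedAddCommGroup U] [NormedSpace ℝ U]
    (X : Type) [NormedAddCommGroup X] [NormedSpace ℝ X] [FiniteDimensional ℝ X]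
    (E : Type) [AddCommGroup E] [Module ℝ E] [FiniteDimensional ℝ E]
    (i : X →L[ℝ] U) (e : E →ₗ[ℝ] U) (he : Function.Injective e) (c : ℝ) (hc : 0 < c)
    (hlow : ∀ x, (1 - c) * ‖x‖ ≤ ‖i x‖) (hup : ∀ x, ‖i x‖ ≤ ‖x‖) :
    ∃ (Z : Type) (_ : NormedAddCommGroup Z) (_ : NormedSpace ℝ Z) (_ : FiniteDimensional ℝ Z)
      (L : (X × E) ≃ₗ[ℝ] Z),
      (∀ x u w, ‖L (x, u)‖ ≤ ‖x - w‖ + ‖e u + i w‖ + c * ‖w‖) ∧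
      (∀ x u r, (∀ w, r ≤ ‖x - w‖ + ‖e u + i w‖ + c * ‖w‖) → r ≤ ‖L (x, u)‖) ∧
      (∀ x, ‖L (x, 0)‖ = ‖x‖) ∧ (∀ u, ‖L (0, u)‖ = ‖e u‖) := by
  classical
  let g : X × E → X → ℝ := fun z w => ‖z.1 - w‖ + ‖e z.2 + i w‖ + c * ‖w‖
  have g0 : ∀ z w, 0 ≤ g z w := fun z w => by positivity
  have bdd : ∀ z, BddBelow (Set.range (g z)) := fun z => ⟨0, by rintro _ ⟨w, rfl⟩; exact g0 z w⟩
  let N : X × E → ℝ := fun z => ⨅ w, g z w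
  have Nle : ∀ z w, N z ≤ g z w := fun z w => ciInf_le (bdd z) w
  have leN : ∀ z r, (∀ w, r ≤ g z w) → r ≤ N z := fun z r h => le_ciInf h
  have N0 : ∀ z, 0 ≤ N z := fun z => leN z 0 (g0 z)
  have hi1 : ‖i‖ ≤ 1 := i.opNorm_le_bound zero_le_one (by simpa using hup)
  have Nadd : ∀ z z', N (z + z') ≤ N z + N z' := by
    intro z z'
    have h1 : ∀ w w', N (z + z') ≤ g z w + g z' w' := by
      intro w w'
      refine (Nle _ (w + w')).trans ?_
      simp only [g, Prod.fst_add, Prod.snd_add, map_add]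
      have a1 : ‖z.1 + z'.1 - (w + w')‖ ≤ ‖z.1 - w‖ + ‖z'.1 - w'‖ := by
        rw [add_sub_add_comm]; exact norm_add_le _ _
      have a2 : ‖e z.2 + e z'.2 + (i w + i w')‖ ≤ ‖e z.2 + i w‖ + ‖e z'.2 + i w'‖ := by
        rw [add_add_add_comm]; exact norm_add_le _ _
      have a3 := mul_le_mul_of_nonneg_left (norm_add_le w w') hc.le
      linarith
    have h2 : N (z + z') - N z ≤ N z' := leN _ _ fun w' => by
      have : N (z + z') - g z' w' ≤ N z := leN _ _ fun w => by linarith [h1 w w']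
      linarith
    linarith
  have Nsmul_le : ∀ (a : ℝ) z, a ≠ 0 → |a| * N z ≤ N (a • z) := by
    intro a z ha
    refine leN _ _ fun w => ?_
    have h := mul_le_mul_of_nonneg_left (Nle z (a⁻¹ • w)) (abs_nonneg a)
    refine h.trans_eq ?_
    simp only [g, mul_add, Prod.smul_fst, Prod.smul_snd, map_smul]
    have a1 : |a| * ‖z.1 - a⁻¹ • w‖ = ‖a • z.1 - w‖ := by
      rw [← Real.norm_eq_abs, ← norm_smul, smul_sub, smul_inv_smul₀ ha]
    have a2 : |a| * ‖e z.2 + a⁻¹ • i w‖ = ‖a • e z.2 + i w‖ := by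
      rw [← Real.norm_eq_abs, ← norm_smul, smul_add, smul_inv_smul₀ ha]
    have a3 : |a| * ‖a⁻¹ • w‖ = ‖w‖ := by
      rw [← Real.norm_eq_abs, ← norm_smul, smul_inv_smul₀ ha]
    rw [a1, a2, mul_left_comm, a3]
  have Nzero : N 0 = 0 := le_antisymm (by simpa [g] using Nle 0 0) (N0 0)
  have Nsmul : ∀ (a : ℝ) z, N (a • z) = |a| * N z := by
    intro a z
    by_cases ha : a = 0
    · subst ha; simp [Nzero]
    · refine le_antisymm ?_ (Nsmul_le a z ha)
      have h := Nsmul_le a⁻¹ (a • z) (inv_ne_zero ha)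
      rw [inv_smul_smul₀ ha, abs_inv] at h
      have hp : 0 < |a| := abs_pos.mpr ha
      rwa [inv_mul_le_iff₀ hp] at h
  have Nx : ∀ x, N (x, 0) = ‖x‖ := by
    intro x
    refine le_antisymm (by simpa [g] using Nle (x, 0) 0) (leN _ _ fun w => ?_)
    simp only [g, map_zero, zero_add]
    have := hlow w
    have := norm_le_norm_sub_add x w
    nlinarith
  have Nu : ∀ u, N (0, u) = ‖e u‖ := by
    intro u
    refine le_antisymm (by simpa [g] using Nle (0, u) 0) (leN _ _ fun w => ?_)
    simp only [g, zero_sub, norm_neg]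
    have h1 := hup w
    have h2 : ‖e u‖ ≤ ‖e u + i w‖ + ‖i w‖ := by
      simpa using norm_sub_le (e u + i w) (i w)
    have : 0 ≤ c * ‖w‖ := by positivity
    linarith
  have Ndef : ∀ z, N z = 0 → z = 0 := by
    rintro ⟨x, u⟩ hz
    have hx : min c 1 * ‖x‖ ≤ N (x, u) := leN _ _ fun w => by
      simp only [g]
      have h1 := norm_le_norm_sub_add x w
      have h2 : min c 1 * ‖x‖ ≤ min c 1 * (‖x - w‖ + ‖w‖) :=
        mul_le_mul_of_nonneg_left h1 (by positivity)
      have h3 : min c 1 * ‖x - w‖ ≤ 1 * ‖x - w‖ :=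
        mul_le_mul_of_nonneg_right (min_le_right _ _) (norm_nonneg _)
      have h4 : min c 1 * ‖w‖ ≤ c * ‖w‖ :=
        mul_le_mul_of_nonneg_right (min_le_left _ _) (norm_nonneg _)
      have h5 := norm_nonneg (e u + i w)
      linarith
    rw [hz] at hx
    have hp : 0 < min c 1 := lt_min hc one_pos
    have hx0 : x = 0 := by
      have : ‖x‖ ≤ 0 := by
        by_contra hh
        push Not at hh
        nlinarith [mul_pos hp hh]
      exact norm_le_zero_iff.mp this
    subst hx0
    rw [Nu] at hz
    have : u = 0 := he (by rw [norm_eq_zero.mp hz, map_zero])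
    rw [this]; rfl
  let : Norm (AmalgSpace X E) := ⟨fun z => N ((amalgEquiv X E).symm z)⟩
  have core : NormedSpace.Core ℝ (AmalgSpace X E) :=
    { norm_nonneg := fun z => N0 _
      norm_smul := fun a z => by
        change N _ = ‖a‖ * N _
        rw [map_smul, Nsmul, Real.norm_eq_abs]
      norm_triangle := fun z z' => by
        change N _ ≤ N _ + N _
        rw [map_add]; exact Nadd _ _
      norm_eq_zero_iff := fun z => by
        constructor
        · intro h
          have := Ndef _ h
          simpa using this
        · rintro rfl
          change N _ = 0
          rw [map_zero, Nzero] }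
  letI i1 : NormedAddCommGroup (AmalgSpace X E) := NormedAddCommGroup.ofCore core
  let i2 : NormedSpace ℝ (AmalgSpace X E) := NormedSpace.ofCore core
  refine ⟨AmalgSpace X E, i1, i2, ?_, amalgEquiv X E, ?_, ?_, ?_, ?_⟩
  · exact Module.Finite.equiv (amalgEquiv X E)
  · exact fun x u w => Nle (x, u) w
  · exact fun x u r h => leN (x, u) r h
  · exact Nx
  · exact Nu

theorem isometry_of_range {U : Type*} [NormedAddCommGroup U] [NormedSpace ℝ U]
    {X E Z : Type} [AddCommGroup X] [Module ℝ X] [AddCommGroup E] [Module ℝ E]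
    [NormedAddCommGroup Z] [NormedSpace ℝ Z] (L : (X × E) ≃ₗ[ℝ] Z) (e : E →ₗ[ℝ] U)
    (h : ∀ u, ‖L (0, u)‖ = ‖e u‖) :
    ∃ i : (LinearMap.range (L.toLinearMap ∘ₗ LinearMap.inr ℝ X E)) →ₗᵢ[ℝ] U,
      ∀ z, i z = e (L.symm z).2 := by
  refine ⟨⟨(e ∘ₗ LinearMap.snd ℝ X E ∘ₗ L.symm.toLinearMap).domRestrict _, ?_⟩, fun z => rfl⟩
  rintro ⟨_, u, rfl⟩
  simp [h]

theorem gurarii_step {U V : Type*} [NormedAddCommGroup U] [NormedSpace ℝ U]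
    [NormedAddCommGroup V] [NormedSpace ℝ V] (Ω : U →L[ℝ] V) (hΩ : ‖Ω‖ ≤ 1)
    (hG : HasGurariiProperty Ω)
    (X Y : Type) [NormedAddCommGroup X] [NormedSpace ℝ X] [FiniteDimensional ℝ X]
    [NormedAddCommGroup Y] [NormedSpace ℝ Y] [FiniteDimensional ℝ Y]
    (T : X →L[ℝ] Y) (hT : ‖T‖ ≤ 1) (ε δ : ℝ) (hε : 0 < ε) (hδ : 0 < δ)
    (i : X →L[ℝ] U) (j : Y →L[ℝ] V) (hi : IsEpsIsometry ε i) (hj : IsEpsIsometry ε j)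
    (hc : ‖Ω.comp i - j.comp T‖ < ε) :
    ∃ (i' : X →L[ℝ] U) (j' : Y →L[ℝ] V), IsEpsIsometry δ i' ∧ IsEpsIsometry δ j' ∧
      ‖Ω.comp i' - j'.comp T‖ < δ ∧ ‖i' - i‖ ≤ 2 * ε + δ ∧ ‖j' - j‖ ≤ 2 * ε + δ := by
  have hinv : 1 - ε ≤ (1 + ε)⁻¹ := by
    rw [← one_div, le_div_iff₀ (by positivity)]
    nlinarith
  have hiinj : Function.Injective i.toLinearMap := by
    rw [← LinearMap.ker_eq_bot, LinearMap.ker_eq_bot']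
    intro x hx
    have h := (hi x).1
    have hx' : i x = 0 := hx
    rw [hx', norm_zero] at h
    have : 0 < (1 + ε)⁻¹ := by positivity
    exact norm_le_zero_iff.mp (by
      by_contra hh
      push Not at hh
      nlinarith [mul_pos this hh])
  let V₀ : Submodule ℝ V := LinearMap.range j.toLinearMap ⊔ LinearMap.range (Ω.comp i).toLinearMap
  let eq := (Module.finBasis ℝ V₀).equivFun
  let f : (Fin (Module.finrank ℝ V₀) → ℝ) →ₗ[ℝ] V := V₀.subtype ∘ₗ eq.symm.toLinearMap
  have hf : Function.Injective f := V₀.injective_subtype.comp eq.symm.injective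
  have hjm : ∀ y, j y ∈ V₀ := fun y => Submodule.mem_sup_left ⟨y, rfl⟩
  have hom : ∀ x, Ω (i x) ∈ V₀ := fun x => Submodule.mem_sup_right ⟨x, rfl⟩
  let S : X →ₗ[ℝ] (Fin (Module.finrank ℝ V₀) → ℝ) :=
    eq.toLinearMap ∘ₗ LinearMap.codRestrict V₀ (Ω.comp i).toLinearMap hom
  let R : Y →ₗ[ℝ] (Fin (Module.finrank ℝ V₀) → ℝ) :=
    eq.toLinearMap ∘ₗ LinearMap.codRestrict V₀ j.toLinearMap hjm
  have hS : ∀ x, f (S x) = Ω (i x) := fun x => by simp [f, S]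
  have hR : ∀ y, f (R y) = j y := fun y => by simp [f, R]
  have hT1 : ∀ x, ‖T x‖ ≤ ‖x‖ := fun x => T.le_of_opNorm_le_of_le hT le_rfl |>.trans (by simp)
  have hΩ1 : ∀ x, ‖Ω x‖ ≤ ‖x‖ := fun x => Ω.le_of_opNorm_le_of_le hΩ le_rfl |>.trans (by simp)
  obtain ⟨Z, _, _, _, L, L1, L2, L3, L4⟩ := amalg_exists X X i i.toLinearMap hiinj (2 * ε)
    (by positivity)
    (fun x => le_trans (mul_le_mul_of_nonneg_right (by linarith) (norm_nonneg _)) (hi x).1)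
    (fun x => (hi x).2)
  obtain ⟨W, _, _, _, M, M1, M2, M3, M4⟩ := amalg_exists Y _ j f hf ε hε
    (fun x => le_trans (mul_le_mul_of_nonneg_right hinv (norm_nonneg _)) (hj x).1)
    (fun x => (hj x).2)
  obtain ⟨i₀, hi₀⟩ := isometry_of_range L i.toLinearMap L4
  obtain ⟨j₀, hj₀⟩ := isometry_of_range M f M4
  let T' : Z →L[ℝ] W := LinearMap.toContinuousLinearMap
    (M.toLinearMap ∘ₗ (T.toLinearMap.prodMap S) ∘ₗ L.symm.toLinearMap)
  have hT' : ∀ x u, T' (L (x, u)) = M (T x, S u) := fun x u => by simp [T']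
  have hTn : ‖T'‖ ≤ 1 := by
    refine T'.opNorm_le_bound zero_le_one fun z => ?_
    obtain ⟨⟨x, u⟩, rfl⟩ := L.surjective z
    rw [one_mul, hT']
    refine L2 x u _ fun w => (M1 _ _ (T w)).trans ?_
    have a1 : ‖T x - T w‖ ≤ ‖x - w‖ := by rw [← map_sub]; exact hT1 _
    have a2 : ‖f (S u) + j (T w)‖ ≤ ‖i u + i w‖ + ε * ‖w‖ := by
      have e1 : f (S u) + j (T w) = Ω (i u + i w) - (Ω.comp i - j.comp T) w := by
        rw [hS]; simp; abel
      rw [e1]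
      refine (norm_sub_le _ _).trans (add_le_add (hΩ1 _) ?_)
      exact ContinuousLinearMap.le_of_opNorm_le _ hc.le _
    have a3 : ε * ‖T w‖ ≤ ε * ‖w‖ := mul_le_mul_of_nonneg_left (hT1 w) hε.le
    change _ ≤ ‖x - w‖ + ‖i u + i w‖ + 2 * ε * ‖w‖
    linarith
  obtain ⟨i', j', h1, h2, h3, h4, h5⟩ := hG δ hδ Z W _ _ T' hTn
    (by
      rintro _ ⟨u, rfl⟩
      refine ⟨S u, ?_⟩
      simp [hT']) i₀ j₀
    (by
      rintro ⟨_, u, rfl⟩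
      rw [hi₀, hj₀]
      simp [hT', hS])
  let A : X →L[ℝ] Z := LinearMap.toContinuousLinearMap (L.toLinearMap ∘ₗ LinearMap.inl ℝ X X)
  let B : Y →L[ℝ] W := LinearMap.toContinuousLinearMap (M.toLinearMap ∘ₗ LinearMap.inl ℝ Y _)
  have hA : ∀ x, A x = L (x, 0) := fun x => by simp [A]
  have hB : ∀ x, B x = M (x, 0) := fun x => by simp [B]
  refine ⟨i'.comp A, j'.comp B, ?_, ?_, ?_, ?_, ?_⟩
  · intro x
    have := h1 (A x)
    rwa [hA, L3, ← hA] at this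
  · intro x
    have := h2 (B x)
    rwa [hB, M3, ← hB] at this
  · have e1 : Ω.comp (i'.comp A) - (j'.comp B).comp T = (Ω.comp i' - j'.comp T').comp A := by
      ext x
      simp [hA, hB, hT']
    rw [e1]
    refine lt_of_le_of_lt ((ContinuousLinearMap.opNorm_comp_le _ _).trans ?_) h5
    have : ‖A‖ ≤ 1 := A.opNorm_le_bound zero_le_one fun x => by rw [hA, L3, one_mul]
    exact mul_le_of_le_one_right (norm_nonneg _) this
  · refine ContinuousLinearMap.opNorm_le_bound _ (by positivity) fun x => ?_
    have e1 : (i'.comp A - i) x = i' (L (x, -x)) + (i' (L (0, x)) - i x) := by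
      have : L (x, 0) = L (x, -x) + L (0, x) := by rw [← map_add]; simp
      simp only [sub_apply, ContinuousLinearMap.comp_apply, hA, this, map_add]
      abel
    rw [e1, add_mul]
    refine (norm_add_le _ _).trans (add_le_add ?_ ?_)
    · refine (h1 _).2.trans ((L1 x (-x) x).trans ?_)
      simp
    · have h := ContinuousLinearMap.le_of_opNorm_le _ h3.le ⟨L (0, x), x, by simp⟩
      replace h : ‖i' (L (0, x)) - i₀ ⟨L (0, x), x, by simp⟩‖ ≤ δ * ‖L (0, x)‖ := h
      have e2 : i₀ ⟨L (0, x), x, by simp⟩ = i x := by simp [hi₀]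
      rw [e2] at h
      refine h.trans (mul_le_mul_of_nonneg_left ?_ hδ.le)
      change ‖L (0, x)‖ ≤ _
      rw [L4]; exact (hi x).2
  · refine ContinuousLinearMap.opNorm_le_bound _ (by positivity) fun x => ?_
    have e1 : (j'.comp B - j) x = j' (M (x, -R x)) + (j' (M (0, R x)) - j x) := by
      have : M (x, 0) = M (x, -R x) + M (0, R x) := by rw [← map_add]; simp
      simp only [sub_apply, ContinuousLinearMap.comp_apply, hB, this, map_add]
      abel
    rw [e1, add_mul]
    refine (norm_add_le _ _).trans (add_le_add ?_ ?_)
    · refine (h2 _).2.trans ((M1 x (-R x) x).trans ?_)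
      have : 0 ≤ ε * ‖x‖ := by positivity
      simp only [sub_self, norm_zero, map_neg, hR, neg_add_cancel]
      linarith
    · have h := ContinuousLinearMap.le_of_opNorm_le _ h4.le ⟨M (0, R x), R x, by simp⟩
      replace h : ‖j' (M (0, R x)) - j₀ ⟨M (0, R x), R x, by simp⟩‖ ≤ δ * ‖M (0, R x)‖ := h
      have e2 : j₀ ⟨M (0, R x), R x, by simp⟩ = j x := by simp [hj₀, hR]
      rw [e2] at h
      refine h.trans (mul_le_mul_of_nonneg_left ?_ hδ.le)
      change ‖M (0, R x)‖ ≤ _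
      rw [M4, hR]; exact (hj x).2

/-- For nonexpansive operators between separable Banach spaces, conditions (G) and (G*)
are equivalent. -/
theorem GurariiProperty_iff_GurariiStarProperty
    {U V : Type*} [NormedAddCommGroup U] [NormedSpace ℝ U] [CompleteSpace U]
    [TopologicalSpace.SeparableSpace U]
    [NormedAddCommGroup V] [NormedSpace ℝ V] [CompleteSpace V]
    [TopologicalSpace.SeparableSpace V]
    (Ω : U →L[ℝ] V) (hΩ : ‖Ω‖ ≤ 1) :
    HasGurariiProperty Ω ↔ HasGurariiStarProperty Ω := by
  constructor
  · intro hG ε hε X Y _ _ _ _ _ _ X₀ Y₀ T hTn hT i j hij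
    have step := gurarii_step Ω hΩ hG X Y T hTn
    let η : ℕ → ℝ := fun n => ε / 8 * (1 / 2) ^ n
    have hη : ∀ n, 0 < η n := fun n => by positivity
    have hη0 : η 0 = ε / 8 := by simp [η]
    have hηs : ∀ n, η (n + 1) = η n / 2 := fun n => by simp only [η]; ring
    have hηle : ∀ n, η n ≤ ε := fun n => by
      have : ((1 : ℝ) / 2) ^ n ≤ 1 := pow_le_one₀ (by norm_num) (by norm_num)
      have : η n ≤ ε / 8 * 1 := mul_le_mul_of_nonneg_left this (by positivity)
      linarith
    have hηlim : Filter.Tendsto η Filter.atTop (nhds 0) := by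
      have := (tendsto_pow_atTop_nhds_zero_of_lt_one (r := (1 / 2 : ℝ)) (by norm_num)
        (by norm_num)).const_mul (ε / 8)
      simpa [η] using this
    obtain ⟨i0, j0, a1, a2, a3, a4, a5⟩ := hG (η 0) (hη 0) X Y X₀ Y₀ T hTn hT i j hij
    let P : ℕ → (X →L[ℝ] U) × (Y →L[ℝ] V) → Prop := fun n p =>
      IsEpsIsometry (η n) p.1 ∧ IsEpsIsometry (η n) p.2 ∧ ‖Ω.comp p.1 - p.2.comp T‖ < η n
    have next : ∀ n (p : {p // P n p}), ∃ q : {q // P (n + 1) q},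
        ‖q.1.1 - p.1.1‖ ≤ 2 * η n + η (n + 1) ∧ ‖q.1.2 - p.1.2‖ ≤ 2 * η n + η (n + 1) := by
      rintro n ⟨p, p1, p2, p3⟩
      obtain ⟨i', j', b1, b2, b3, b4, b5⟩ := step (η n) (η (n + 1)) (hη _) (hη _) p.1 p.2 p1 p2 p3
      exact ⟨⟨(i', j'), b1, b2, b3⟩, b4, b5⟩
    choose nx hnx using next
    let s : ∀ n, {p // P n p} := fun n => Nat.rec ⟨(i0, j0), a1, a2, a5⟩ (fun n p => nx n p) n
    have s0 : (s 0).1 = (i0, j0) := rfl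
    have ss : ∀ n, s (n + 1) = nx n (s n) := fun n => rfl
    have d1 : ∀ n, dist (s n).1.1 (s (n + 1)).1.1 ≤ 3 * ε / 8 * (1 / 2) ^ n := fun n => by
      rw [dist_comm, dist_eq_norm, ss]
      refine (hnx n (s n)).1.trans ?_
      rw [hηs]
      have := (hη n).le
      have e : 3 * ε / 8 * (1 / 2) ^ n = 3 * η n := by simp only [η]; ring
      linarith
    have d2 : ∀ n, dist (s n).1.2 (s (n + 1)).1.2 ≤ 3 * ε / 8 * (1 / 2) ^ n := fun n => by
      rw [dist_comm, dist_eq_norm, ss]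
      refine (hnx n (s n)).2.trans ?_
      rw [hηs]
      have := (hη n).le
      have e : 3 * ε / 8 * (1 / 2) ^ n = 3 * η n := by simp only [η]; ring
      linarith
    obtain ⟨I, hI⟩ := cauchySeq_tendsto_of_complete
      (cauchySeq_of_le_geometric (1 / 2 : ℝ) _ (by norm_num) d1)
    obtain ⟨J, hJ⟩ := cauchySeq_tendsto_of_complete
      (cauchySeq_of_le_geometric (1 / 2 : ℝ) _ (by norm_num) d2)
    have D1 := dist_le_of_le_geometric_of_tendsto₀ (1 / 2 : ℝ) _ (by norm_num) d1 hI
    have D2 := dist_le_of_le_geometric_of_tendsto₀ (1 / 2 : ℝ) _ (by norm_num) d2 hJ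
    rw [s0, dist_comm, dist_eq_norm] at D1 D2
    have Ix : ∀ x, Filter.Tendsto (fun n => (s n).1.1 x) Filter.atTop (nhds (I x)) := fun x =>
      ((ContinuousLinearMap.apply ℝ U x).continuous.tendsto I).comp hI
    have Jx : ∀ x, Filter.Tendsto (fun n => (s n).1.2 x) Filter.atTop (nhds (J x)) := fun x =>
      ((ContinuousLinearMap.apply ℝ V x).continuous.tendsto J).comp hJ
    have hmono : ∀ n, (1 + ε)⁻¹ ≤ (1 + η n)⁻¹ := fun n =>
      inv_anti₀ (by have := hη n; positivity) (by linarith [hηle n])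
    refine ⟨I, J, ?_, ?_, ?_, ?_, ?_⟩
    · intro x
      refine ⟨ge_of_tendsto' (Ix x).norm fun n => ?_, le_of_tendsto' (Ix x).norm fun n =>
        ((s n).2.1 x).2⟩
      exact (mul_le_mul_of_nonneg_right (hmono n) (norm_nonneg _)).trans ((s n).2.1 x).1
    · intro x
      refine ⟨ge_of_tendsto' (Jx x).norm fun n => ?_, le_of_tendsto' (Jx x).norm fun n =>
        ((s n).2.2.1 x).2⟩
      exact (mul_le_mul_of_nonneg_right (hmono n) (norm_nonneg _)).trans ((s n).2.2.1 x).1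
    · have e : I.comp X₀.subtypeL - i.toContinuousLinearMap = (I - i0).comp X₀.subtypeL +
          (i0.comp X₀.subtypeL - i.toContinuousLinearMap) := by ext x; simp
      rw [e]
      have hb : ‖(I - i0).comp X₀.subtypeL‖ ≤ ‖I - i0‖ :=
        ContinuousLinearMap.opNorm_le_bound _ (norm_nonneg _) fun x => (I - i0).le_opNorm x
      have := norm_add_le ((I - i0).comp X₀.subtypeL)
        (i0.comp X₀.subtypeL - i.toContinuousLinearMap)
      have D : ‖I - i0‖ ≤ 3 / 4 * ε := D1.trans_eq (by ring)
      rw [hη0] at a3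
      refine lt_of_le_of_lt (this.trans (add_le_add (hb.trans D) a3.le)) ?_
      linarith
    · have e : J.comp Y₀.subtypeL - j.toContinuousLinearMap = (J - j0).comp Y₀.subtypeL +
          (j0.comp Y₀.subtypeL - j.toContinuousLinearMap) := by ext x; simp
      rw [e]
      have hb : ‖(J - j0).comp Y₀.subtypeL‖ ≤ ‖J - j0‖ :=
        ContinuousLinearMap.opNorm_le_bound _ (norm_nonneg _) fun x => (J - j0).le_opNorm x
      have := norm_add_le ((J - j0).comp Y₀.subtypeL)
        (j0.comp Y₀.subtypeL - j.toContinuousLinearMap)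
      have D : ‖J - j0‖ ≤ 3 / 4 * ε := D2.trans_eq (by ring)
      rw [hη0] at a4
      refine lt_of_le_of_lt (this.trans (add_le_add (hb.trans D) a4.le)) ?_
      linarith
    · ext x
      have t1 : Filter.Tendsto (fun n => Ω ((s n).1.1 x) - (s n).1.2 (T x)) Filter.atTop
          (nhds (Ω (I x) - J (T x))) :=
        ((Ω.continuous.tendsto _).comp (Ix x)).sub (Jx (T x))
      have t2 : Filter.Tendsto (fun n => Ω ((s n).1.1 x) - (s n).1.2 (T x)) Filter.atTop
          (nhds 0) := by
        refine squeeze_zero_norm (a := fun n => η n * ‖x‖) (fun n => ?_)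
          (by simpa using hηlim.mul_const ‖x‖)
        exact ContinuousLinearMap.le_of_opNorm_le _ (s n).2.2.2.le x
      exact sub_eq_zero.mp (tendsto_nhds_unique t1 t2)
  · intro hG ε hε X Y _ _ _ _ _ _ X₀ Y₀ T hTn hT i j hij
    obtain ⟨i', j', h1, h2, h3, h4, h5⟩ := hG ε hε X Y X₀ Y₀ T hTn hT i j hij
    exact ⟨i', j', h1, h2, h3, h4, by rw [h5, sub_self, norm_zero]; exact hε⟩
end

section
/- Let Ω: U→V be a nonexpansive linear operator between Banach spaces satisfying condition (G*). Then Ω is surjective. -/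
theorem approx_preimage_of_star
    {U V : Type*} [NormedAddCommGroup U] [NormedSpace ℝ U]
    [NormedAddCommGroup V] [NormedSpace ℝ V]
    (Ω : U →L[ℝ] V) (hG : HasGurariiStarProperty Ω) (v : V) :
    ∃ u : U, ‖u‖ ≤ ‖v‖ ∧ ‖v - Ω u‖ ≤ 1 / 2 * ‖v‖ := by
  by_cases hv : v = 0
  · exact ⟨0, by simp [hv]⟩
  have hn : ‖v‖ ≠ 0 := norm_ne_zero_iff.mpr hv
  have hw : ‖(‖v‖⁻¹ • v)‖ = 1 := by
    rw [norm_smul, norm_inv, norm_norm, inv_mul_cancel₀ hn]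
  let j : (⊤ : Submodule ℝ ℝ) →ₗᵢ[ℝ] V :=
    (LinearIsometry.toSpanSingleton ℝ V hw).comp
      (Submodule.subtypeₗᵢ ⊤)
  let i : (⊥ : Submodule ℝ ℝ) →ₗᵢ[ℝ] U :=
    { toLinearMap := 0
      norm_map' := fun x => by
        rw [Subsingleton.elim x 0]; simp }
  obtain ⟨i', j', hi, -, -, hj, hc⟩ := hG (1 / 2) (by norm_num) ℝ ℝ ⊥ ⊤
    (ContinuousLinearMap.id ℝ ℝ) ContinuousLinearMap.norm_id_le
    (fun _ _ => trivial) i j (fun x => by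
      rw [Subsingleton.elim x 0]
      have : (⟨(ContinuousLinearMap.id ℝ ℝ) ((0 : (⊥ : Submodule ℝ ℝ)) : ℝ), trivial⟩ :
        (⊤ : Submodule ℝ ℝ)) = 0 := rfl
      rw [this, map_zero, map_zero, map_zero])
  have h1 := (j'.comp (⊤ : Submodule ℝ ℝ).subtypeL - j.toContinuousLinearMap).le_of_opNorm_le
    hj.le ⟨‖v‖, trivial⟩
  have h2 := congrArg (fun f => f ‖v‖) hc
  have h3 : j ⟨‖v‖, trivial⟩ = v := by
    change ‖v‖ • (‖v‖⁻¹ • v) = v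
    rw [smul_smul, mul_inv_cancel₀ hn, one_smul]
  refine ⟨i' ‖v‖, by simpa using (hi ‖v‖).2, ?_⟩
  have h4 : Ω (i' ‖v‖) = j' ‖v‖ := by simpa using h2
  rw [h4, norm_sub_rev]
  have h5 : ‖j' ‖v‖ - j ⟨‖v‖, trivial⟩‖ ≤ 1 / 2 * ‖(‖v‖ : ℝ)‖ := h1
  rwa [h3, norm_norm] at h5

/-- An operator satisfying condition (G*) is surjective. -/
theorem surjective_of_GurariiStarProperty
    {U V : Type*} [NormedAddCommGroup U] [NormedSpace ℝ U] [CompleteSpace U]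
    [NormedAddCommGroup V] [NormedSpace ℝ V] [CompleteSpace V]
    (Ω : U →L[ℝ] V) (hΩ : ‖Ω‖ ≤ 1) (hG : HasGurariiStarProperty Ω) :
    Function.Surjective Ω := by
  choose g hg1 hg2 using approx_preimage_of_star Ω hG
  intro v
  let r : ℕ → V := fun n => (fun w => w - Ω (g w))^[n] v
  have hr : ∀ n, r (n + 1) = r n - Ω (g (r n)) := fun n =>
    Function.iterate_succ_apply' _ _ _
  have hb : ∀ n, ‖r n‖ ≤ (1 / 2) ^ n * ‖v‖ := by
    intro n
    induction n with
    | zero => simp [r]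
    | succ n ih =>
      rw [hr]
      have := hg2 (r n)
      rw [pow_succ]
      linarith
  have hs : Summable fun n : ℕ => (1 / 2 : ℝ) ^ n * ‖v‖ := summable_geometric_two.mul_right _
  have hu : Summable fun n => g (r n) :=
    Summable.of_norm_bounded hs fun n => (hg1 _).trans (hb n)
  refine ⟨∑' n, g (r n), ?_⟩
  have hsum : ∀ n, ∑ k ∈ Finset.range n, Ω (g (r k)) = v - r n := by
    intro n
    induction n with
    | zero => simp [r]
    | succ n ih => rw [Finset.sum_range_succ, ih, hr]; abel
  have ht := (Ω.hasSum hu.hasSum).tendsto_sum_nat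
  have h0 : Filter.Tendsto r Filter.atTop (nhds 0) :=
    squeeze_zero_norm hb hs.tendsto_atTop_zero
  have h1 := h0.const_sub v
  rw [sub_zero] at h1
  exact tendsto_nhds_unique ht (h1.congr fun n => (hsum n).symm)
end
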